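/- Suppose ℍ-hulls F_n (n ∈ ℕ) and F_∞ are all contained in a fixed ℍ-hull F̃ with Im F̃ := sup{Im z : z ∈ F̃} < ∞ and hcap(F̃) < ∞, and F_n converges to F_∞ in Carathéodory's sense (ℍ\F_n → ℍ\F_∞ in the kernel sense with respect to some z₀ ∈ ℍ\F̃). Then hcap(F_n) → hcap(F_∞) as n → ∞. -/

import Mathlib

open MeasureTheory Filter

/-- The complex upper half-plane. -/
def UH : Set ℂ := {z | 0 < z.im}

/-- A planar Brownian motion with sample space `Ω`: a family of probability
measures `P w` (the law of Brownian motion started at `w`), with continuous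
paths, Gaussian increments and independent increments. -/
structure PlanarBM (Ω : Type*) [MeasurableSpace Ω] where
  Z : ℝ → Ω → ℂ
  P : ℂ → Measure Ω
  isProb : ∀ w, IsProbabilityMeasure (P w)
  meas : ∀ t, Measurable (Z t)
  start : ∀ w, ∀ᵐ ω ∂P w, Z 0 ω = w
  contPaths : ∀ w, ∀ᵐ ω ∂P w, Continuous fun t => Z t ω
  incrLaw : ∀ (w : ℂ) (s t : ℝ), 0 ≤ s → s ≤ t →
    (P w).map (fun ω => Z t ω - Z s ω) =
      (((ProbabilityTheory.gaussianReal 0 (Real.toNNReal (t - s))).prod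
        (ProbabilityTheory.gaussianReal 0 (Real.toNNReal (t - s)))).map
        fun p : ℝ × ℝ => Complex.equivRealProd.symm p)
  indepIncr : ∀ (w : ℂ) (s t : ℝ), 0 ≤ s → s ≤ t →
    ProbabilityTheory.IndepFun (fun ω => Z t ω - Z s ω)
      (fun ω => fun u : Set.Iic s => Z u.1 ω) (P w)

/-- First hitting time of the set `A` by the path `f` (∞ if never hit). -/
noncomputable def hitTime (f : ℝ → ℂ) (A : Set ℂ) : ENNReal :=
  sInf (ENNReal.ofReal '' {t : ℝ | 0 ≤ t ∧ f t ∈ A})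

/-- First exit time of the path `f` from the set `D`. -/
noncomputable def exitTime (f : ℝ → ℂ) (D : Set ℂ) : ENNReal :=
  hitTime f Dᶜ

/-- The path `f` exits the domain `D` (in finite time) through the set `B`. -/
def exitsInto (f : ℝ → ℂ) (D B : Set ℂ) : Prop :=
  ∃ t : ℝ, 0 ≤ t ∧ ENNReal.ofReal t = exitTime f D ∧ f t ∈ B

/-- Harmonic measure of `B` in `D` seen from `z`: the probability that Brownian
motion started at `z` exits `D` through `B`. -/
noncomputable def Hm {Ω : Type*} [MeasurableSpace Ω] (BM : PlanarBM Ω)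
    (D B : Set ℂ) (z : ℂ) : ENNReal :=
  BM.P z {ω | exitsInto (fun t => BM.Z t ω) D B}

/-- `F` is an ℍ-hull: `F ⊆ ℍ`, `F` is relatively closed in ℍ, and `ℍ \ F` is a
simply connected domain. -/
def IsHHull (F : Set ℂ) : Prop :=
  F ⊆ UH ∧ closure F ∩ UH = F ∧ SimplyConnectedSpace (UH \ F : Set ℂ)

/-- Carathéodory kernel convergence of domains with respect to the point `z₀`. -/
def KernelConvergesTo (D : ℕ → Set ℂ) (Dinf : Set ℂ) (z₀ : ℂ) : Prop :=
  (∀ K : Set ℂ, IsCompact K → K ⊆ Dinf → ∀ᶠ n in Filter.atTop, K ⊆ D n) ∧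
  (∀ U : Set ℂ, IsOpen U → IsConnected U → z₀ ∈ U → {n | U ⊆ D n}.Infinite → U ⊆ Dinf)

open scoped Classical in
/-- The imaginary part of the path `f` at the hitting time of `F`, provided `F`
is hit (in finite time) before the path leaves ℍ; zero otherwise (absorption). -/
noncomputable def imAtHit (f : ℝ → ℂ) (F : Set ℂ) : ℝ :=
  if h : ∃ t : ℝ, 0 ≤ t ∧ ENNReal.ofReal t = hitTime f F ∧ hitTime f F < exitTime f UH
  then (f h.choose).im else 0

/-- `hcap F = a`: the half-plane capacity of `F`, defined by
`hcap F = lim_{y→∞} y E_{iy}[Im Z_{σ_F}]` for absorbed Brownian motion in ℍ. -/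
def HasHcap {Ω : Type*} [MeasurableSpace Ω] (BM : PlanarBM Ω) (F : Set ℂ) (a : ℝ) : Prop :=
  Tendsto
    (fun y : ℝ => y * ∫ ω, imAtHit (fun t => BM.Z t ω) F ∂BM.P ((y : ℂ) * Complex.I))
    atTop (nhds a)

namespace HcapBM

open Complex Topology Set ProbabilityTheory
open scoped NNReal ENNReal BoundedContinuousFunction FourierTransform

section LogBranch

/-- Along a path in the slit plane, the variation of any continuous logarithm is that of the
principal one. -/
lemma log_variation {a b : ℝ} (hab : a ≤ b) {h G : ℝ → ℂ} (hh : ContinuousOn h (Icc a b))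
    (hG : ContinuousOn G (Icc a b)) (he : ∀ s ∈ Icc a b, exp (h s) = G s)
    (hs : ∀ s ∈ Icc a b, G s ∈ slitPlane) :
    h b - h a = log (G b) - log (G a) := by
  have hc : ContinuousOn (fun s => (h s - log (G s)) / (2 * Real.pi * I)) (Icc a b) :=
    (hh.sub (hG.clog hs)).div_const _
  have hint : ∀ s ∈ Icc a b, ∃ n : ℤ, (h s - log (G s)) / (2 * Real.pi * I) = n := by
    intro s hsm
    have h1 : exp (h s) = exp (log (G s)) := by
      rw [he s hsm, exp_log (slitPlane_ne_zero (hs s hsm))]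
    obtain ⟨n, hn⟩ := exp_eq_exp_iff_exists_int.1 h1
    refine ⟨n, ?_⟩
    rw [hn]
    field_simp [two_pi_I_ne_zero]
    ring
  have hconst := (isPreconnected_Icc (a := a) (b := b)).constant_of_mapsTo
    (T := range ((↑) : ℤ → ℂ)) ?_ hc
    (fun s hsm => by obtain ⟨n, hn⟩ := hint s hsm; exact ⟨n, hn.symm⟩)
    (left_mem_Icc.2 hab) (right_mem_Icc.2 hab)
  · have := two_pi_I_ne_zero
    rw [div_left_inj' this] at hconst
    linear_combination -hconst
  · exact ⟨Complex.isClosedEmbedding_intCast.isEmbedding.toHomeomorph.symm.isEmbedding.discreteTopology⟩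

lemma log_neg_of_im_pos {z : ℂ} (hz : 0 < z.im) : log (-z) = log z - Real.pi * I := by
  rw [log, log, norm_neg, arg_neg_eq_arg_sub_pi_of_im_pos hz]; push_cast; ring

lemma log_neg_of_im_neg {z : ℂ} (hz : z.im < 0) : log (-z) = log z + Real.pi * I := by
  rw [log, log, norm_neg, arg_neg_eq_arg_add_pi_of_im_neg hz]; push_cast; ring

/-- Variation of a continuous logarithm along a path avoiding the positive real axis. -/
lemma log_variation_neg {a b : ℝ} (hab : a ≤ b) {h G : ℝ → ℂ} (hh : ContinuousOn h (Icc a b))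
    (hG : ContinuousOn G (Icc a b)) (he : ∀ s ∈ Icc a b, exp (h s) = G s)
    (hs : ∀ s ∈ Icc a b, -G s ∈ slitPlane) :
    h b - h a = log (-G b) - log (-G a) := by
  have := log_variation hab (h := fun s => h s + Real.pi * I) (G := fun s => -G s)
    (hh.add continuousOn_const) hG.neg
    (fun s hsm => by rw [exp_add, exp_pi_mul_I, he s hsm]; ring) hs
  simpa using this

/-- A two-dimensional intermediate value theorem. -/
lemma exists_zero_of_rectangle {a b c d : ℝ} (hab : a ≤ b) (hcd : c ≤ d) {G : ℝ × ℝ → ℂ}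
    (hG : Continuous G) (hl : ∀ t ∈ Icc c d, (G (a, t)).re < 0)
    (hr : ∀ t ∈ Icc c d, 0 < (G (b, t)).re) (hb : ∀ s ∈ Icc a b, 0 < (G (s, c)).im)
    (ht : ∀ s ∈ Icc a b, (G (s, d)).im < 0) :
    ∃ s ∈ Icc a b, ∃ t ∈ Icc c d, G (s, t) = 0 := by
  by_contra! hne
  have hcl : Continuous fun p : ℝ × ℝ =>
      G ((projIcc a b hab p.1 : ℝ), (projIcc c d hcd p.2 : ℝ)) := by fun_prop
  obtain ⟨H, hHc, hH⟩ := exists_continuousOn_eqOn_exp_comp (X := ℝ × ℝ) (U := univ)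
    (Homeomorph.Set.univ (ℝ × ℝ)).toHomotopyEquiv.simplyConnectedSpace isOpen_univ hcl.continuousOn
    (by
      rintro ⟨p, -, hp⟩
      exact hne _ (projIcc a b hab p.1).2 _ (projIcc c d hcd p.2).2 hp)
  have hHc' : Continuous H := continuousOn_univ.1 hHc
  have hHe : ∀ s ∈ Icc a b, ∀ t ∈ Icc c d, exp (H (s, t)) = G (s, t) := by
    intro s hs t ht
    have := hH (mem_univ (s, t))
    simpa [projIcc_of_mem hab hs, projIcc_of_mem hcd ht] using this
  have e1 := log_variation hab (h := fun s => H (s, c)) (G := fun s => G (s, c))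
    (by fun_prop) (by fun_prop) (fun s hs => hHe s hs c (left_mem_Icc.2 hcd))
    (fun s hs => Or.inr (hb s hs).ne')
  have e2 := log_variation hcd (h := fun t => H (b, t)) (G := fun t => G (b, t))
    (by fun_prop) (by fun_prop) (fun t ht => hHe b (right_mem_Icc.2 hab) t ht)
    (fun t ht => Or.inl (hr t ht))
  have e3 := log_variation hab (h := fun s => H (s, d)) (G := fun s => G (s, d))
    (by fun_prop) (by fun_prop) (fun s hs => hHe s hs d (right_mem_Icc.2 hcd))
    (fun s hs => Or.inr (ht s hs).ne)
  have e4 := log_variation_neg hcd (h := fun t => H (a, t)) (G := fun t => G (a, t))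
    (by fun_prop) (by fun_prop) (fun t ht => hHe a (left_mem_Icc.2 hab) t ht)
    (fun t ht => Or.inl (by simpa using hl t ht))
  rw [log_neg_of_im_pos (hb a (left_mem_Icc.2 hab)),
    log_neg_of_im_neg (ht a (left_mem_Icc.2 hab))] at e4
  have : (2 * Real.pi * I : ℂ) = 0 := by linear_combination e1 + e2 - e3 - e4
  exact two_pi_I_ne_zero this

end LogBranch

section Loop

/-- The ramp from `0` to `1` on the unit interval. -/
noncomputable def ramp (t : ℝ) : ℝ := max 0 (min 1 t)

/-- A self-crossing polygonal loop around the origin, starting at the origin. -/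
noncomputable def loopPath (t : ℝ) : ℂ :=
  ⟨3 * ramp t - 6 * ramp (t - 2) + 5 * ramp (t - 4),
    3 * ramp (t - 1) - 6 * ramp (t - 3) + 4 * ramp (t - 5)⟩

lemma ramp_lipschitz (s t : ℝ) : |ramp s - ramp t| ≤ |s - t| := by
  unfold ramp
  refine (abs_max_sub_max_le_max _ _ _ _).trans (max_le (by simp) ?_)
  exact (abs_min_sub_min_le_max _ _ _ _).trans (max_le (by simp) le_rfl)

lemma loopPath_zero : loopPath 0 = 0 := by
  apply Complex.ext <;> simp [loopPath, ramp]

lemma loopPath_lipschitz (s t : ℝ) : ‖loopPath s - loopPath t‖ ≤ 27 * |s - t| := by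
  have h0 := abs_le.1 (ramp_lipschitz s t)
  have h1 := abs_le.1 (ramp_lipschitz (s - 1) (t - 1))
  have h2 := abs_le.1 (ramp_lipschitz (s - 2) (t - 2))
  have h3 := abs_le.1 (ramp_lipschitz (s - 3) (t - 3))
  have h4 := abs_le.1 (ramp_lipschitz (s - 4) (t - 4))
  have h5 := abs_le.1 (ramp_lipschitz (s - 5) (t - 5))
  simp only [sub_sub_sub_cancel_right] at h1 h2 h3 h4 h5
  refine (Complex.norm_le_abs_re_add_abs_im _).trans ?_
  have hr : |(loopPath s - loopPath t).re| ≤ 14 * |s - t| := by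
    simp only [loopPath, Complex.sub_re]; rw [abs_le]; constructor <;> linarith
  have hi : |(loopPath s - loopPath t).im| ≤ 13 * |s - t| := by
    simp only [loopPath, Complex.sub_im]; rw [abs_le]; constructor <;> linarith
  linarith

/-- A path close to a dilated self-crossing loop cannot stay in a simply connected domain
omitting a point near the centre of the loop. -/
lemma exists_notMem_of_near_loop {D : Set ℂ} (hD : IsOpen D) (hsc : SimplyConnectedSpace D)
    {γ : ℝ → ℂ} (hγ : Continuous γ) {ρ : ℝ} (hρ : 0 < ρ) {c w : ℂ} (hw : w ∉ D)
    (hwc : ‖w - c‖ ≤ ρ / 8)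
    (hnear : ∀ s ∈ Icc (0 : ℝ) 6, ‖γ s - c - ρ * loopPath s‖ ≤ ρ / 4) :
    ∃ s ∈ Icc (0 : ℝ) 6, γ s ∉ D := by
  by_contra! hin
  have hsc' : IsSimplyConnected D := hsc
  have hρ' : (ρ : ℂ) ≠ 0 := by exact_mod_cast hρ.ne'
  obtain ⟨ℓ, hℓc, hℓ⟩ := exists_continuousOn_eqOn_exp_comp hsc' hD
    (g := fun z => (z - w) / ρ) (by fun_prop)
    (by rintro ⟨z, hz, h0⟩
        have : z = w := by simpa [sub_eq_zero, hρ'] using h0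
        exact hw (this ▸ hz))
  set G : ℝ → ℂ := fun s => (γ s - w) / ρ with hGdef
  have hGc : Continuous G := by fun_prop
  have hGφ : ∀ s ∈ Icc (0 : ℝ) 6, ‖G s - loopPath s‖ ≤ 3 / 8 := by
    intro s hs
    have h1 : G s - loopPath s = ((γ s - c - ρ * loopPath s) - (w - c)) / ρ := by
      simp only [hGdef]; field_simp; ring
    rw [h1, norm_div, Complex.norm_real, Real.norm_of_nonneg hρ.le, div_le_iff₀ hρ]
    refine (norm_sub_le _ _).trans ?_
    linarith [hnear s hs]
  have hre : ∀ s ∈ Icc (0 : ℝ) 6, |(G s).re - (loopPath s).re| ≤ 3 / 8 := fun s hs => by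
    simpa using (Complex.abs_re_le_norm _).trans (hGφ s hs)
  have him : ∀ s ∈ Icc (0 : ℝ) 6, |(G s).im - (loopPath s).im| ≤ 3 / 8 := fun s hs => by
    simpa using (Complex.abs_im_le_norm _).trans (hGφ s hs)
  have hramp0 : ∀ t : ℝ, t ≤ 0 → ramp t = 0 := fun t ht => by
    unfold ramp; rw [min_eq_right (by linarith), max_eq_left ht]
  have hramp1 : ∀ t : ℝ, 1 ≤ t → ramp t = 1 := fun t ht => by
    unfold ramp; rw [min_eq_left ht, max_eq_right zero_le_one]
  have hrampm : ∀ t : ℝ, 0 ≤ t → t ≤ 1 → ramp t = t := fun t h0 h1 => by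
    unfold ramp; rw [min_eq_right h1, max_eq_right h0]
  set h : ℝ → ℂ := fun s => ℓ (γ s) with hhdef
  have hhc : ContinuousOn h (Icc 0 6) := hℓc.comp hγ.continuousOn hin
  have hhe : ∀ s ∈ Icc (0 : ℝ) 6, exp (h s) = G s := fun s hs => hℓ (hin s hs)
  have bre := fun s (hs : s ∈ Icc (0 : ℝ) 6) => abs_le.1 (hre s hs)
  have bim := fun s (hs : s ∈ Icc (0 : ℝ) 6) => abs_le.1 (him s hs)
  simp only [loopPath] at bre bim
  -- the first leg moves right along the positive real axis
  have leg0 : ∀ s ∈ Icc (1 / 3 : ℝ) 1, |(G s).re - 3 * s| ≤ 3 / 8 ∧ |(G s).im| ≤ 3 / 8 := by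
    intro s ⟨h1, h2⟩
    have hs : s ∈ Icc (0 : ℝ) 6 := ⟨by linarith, by linarith⟩
    have r := bre s hs
    have i := bim s hs
    rw [hrampm s (by linarith) h2, hramp0 (s - 2) (by linarith), hramp0 (s - 4) (by linarith)] at r
    rw [hramp0 (s - 1) (by linarith), hramp0 (s - 3) (by linarith),
      hramp0 (s - 5) (by linarith)] at i
    constructor <;> rw [abs_le] <;> constructor <;> linarith
  have leg5 : ∀ s ∈ Icc (5 : ℝ) 6, |(G s).re - 2| ≤ 3 / 8 ∧ |(G s).im - (4 * s - 23)| ≤ 3 / 8 := by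
    intro s ⟨h1, h2⟩
    have hs : s ∈ Icc (0 : ℝ) 6 := ⟨by linarith, by linarith⟩
    have r := bre s hs
    have i := bim s hs
    rw [hramp1 s (by linarith), hramp1 (s - 2) (by linarith), hramp1 (s - 4) (by linarith)] at r
    rw [hramp1 (s - 1) (by linarith), hramp1 (s - 3) (by linarith),
      hrampm (s - 5) (by linarith) (by linarith)] at i
    constructor <;> rw [abs_le] <;> constructor <;> linarith
  have right1 : ∀ s ∈ Icc (1 / 3 : ℝ) (5 / 2), 0 < (G s).re ∨ 0 < (G s).im := by
    intro s ⟨h1, h2⟩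
    have hs : s ∈ Icc (0 : ℝ) 6 := ⟨by linarith, by linarith⟩
    rcases le_total s 1 with h3 | h3
    · have := abs_le.1 (leg0 s ⟨h1, h3⟩).1
      left; linarith
    · rcases le_total s 2 with h4 | h4
      · have r := bre s hs
        rw [hramp1 s h3, hramp0 (s - 2) (by linarith), hramp0 (s - 4) (by linarith)] at r
        left; linarith
      · have i := bim s hs
        rw [hramp1 (s - 1) (by linarith), hramp0 (s - 3) (by linarith),
          hramp0 (s - 5) (by linarith)] at i
        right; linarith
  have top : 0 < (G (5 / 2)).im := by
    have i := bim (5 / 2) ⟨by norm_num, by norm_num⟩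
    rw [hramp1 _ (by norm_num), hramp0 _ (by norm_num), hramp0 _ (by norm_num)] at i
    linarith
  have bot : (G (23 / 5)).im < 0 := by
    have i := bim (23 / 5) ⟨by norm_num, by norm_num⟩
    rw [hramp1 _ (by norm_num), hramp1 _ (by norm_num), hramp0 _ (by norm_num)] at i
    linarith
  have left : ∀ s ∈ Icc (5 / 2 : ℝ) (23 / 5), (G s).re < 0 ∨ (G s).im ≠ 0 := by
    intro s ⟨h1, h2⟩
    have hs : s ∈ Icc (0 : ℝ) 6 := ⟨by linarith, by linarith⟩
    rcases le_total s 3 with h3 | h3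
    · have i := bim s hs
      rw [hramp1 (s - 1) (by linarith), hramp0 (s - 3) (by linarith),
          hramp0 (s - 5) (by linarith)] at i
      right; linarith
    · rcases le_total s 4 with h4 | h4
      · have r := bre s hs
        rw [hramp1 s (by linarith), hramp1 (s - 2) (by linarith), hramp0 (s - 4) (by linarith)] at r
        left; linarith
      · have i := bim s hs
        rw [hramp1 (s - 1) (by linarith), hramp1 (s - 3) (by linarith),
          hramp0 (s - 5) (by linarith)] at i
        right; linarith
  have right2 : ∀ s ∈ Icc (23 / 5 : ℝ) 6, 0 < (G s).re ∨ (G s).im ≠ 0 := by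
    intro s ⟨h1, h2⟩
    have hs : s ∈ Icc (0 : ℝ) 6 := ⟨by linarith, by linarith⟩
    rcases le_total s 5 with h3 | h3
    · have i := bim s hs
      rw [hramp1 (s - 1) (by linarith), hramp1 (s - 3) (by linarith),
          hramp0 (s - 5) (by linarith)] at i
      right; linarith
    · have := abs_le.1 (leg5 s ⟨h3, h2⟩).1
      left; linarith
  obtain ⟨s, hs, t, ht, hst⟩ := exists_zero_of_rectangle (a := 1 / 3) (b := 1) (c := 5) (d := 6)
    (by norm_num) (by norm_num) (G := fun p => G p.1 - G p.2) (by fun_prop)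
    (fun t ht => by
      have h1 := abs_le.1 (leg0 (1 / 3) ⟨by norm_num, by norm_num⟩).1
      have h2 := abs_le.1 (leg5 t ht).1
      simp only [sub_re]; linarith)
    (fun t ht => by
      have h1 := abs_le.1 (leg0 1 ⟨by norm_num, by norm_num⟩).1
      have h2 := abs_le.1 (leg5 t ht).1
      simp only [sub_re]; linarith)
    (fun s hs => by
      have h1 := abs_le.1 (leg0 s hs).2
      have h2 := abs_le.1 (leg5 5 ⟨by norm_num, by norm_num⟩).2
      simp only [sub_im]; linarith)
    (fun s hs => by
      have h1 := abs_le.1 (leg0 s hs).2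
      have h2 := abs_le.1 (leg5 6 ⟨by norm_num, by norm_num⟩).2
      simp only [sub_im]; linarith)
  have hγst : γ s = γ t := by
    have h1 : (γ s - w) / ρ = (γ t - w) / ρ := sub_eq_zero.1 hst
    rw [div_left_inj' hρ'] at h1
    exact sub_left_injective h1
  have hsub : ∀ {x y : ℝ}, 0 ≤ x → y ≤ 6 → Icc x y ⊆ Icc (0 : ℝ) 6 :=
    fun h0 h6 => Icc_subset_Icc h0 h6
  have e1 := log_variation (a := s) (b := 5 / 2) (by linarith [hs.2])
    (hhc.mono (hsub (by linarith [hs.1]) (by norm_num))) hGc.continuousOn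
    (fun u hu => hhe u (hsub (by linarith [hs.1]) (by norm_num) hu))
    (fun u hu => by
      rcases right1 u ⟨hs.1.trans hu.1, hu.2⟩ with h | h
      · exact Or.inl h
      · exact Or.inr h.ne')
  have e2 := log_variation_neg (a := 5 / 2) (b := 23 / 5) (by norm_num)
    (hhc.mono (hsub (by norm_num) (by norm_num))) hGc.continuousOn
    (fun u hu => hhe u (hsub (by norm_num) (by norm_num) hu))
    (fun u hu => by
      rcases left u hu with h | h
      · exact Or.inl (by simpa using h)
      · exact Or.inr (by simpa using h))
  have e3 := log_variation (a := 23 / 5) (b := t) (by linarith [ht.1])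
    (hhc.mono (hsub (by norm_num) ht.2)) hGc.continuousOn
    (fun u hu => hhe u (hsub (by norm_num) ht.2 hu))
    (fun u hu => right2 u ⟨hu.1, hu.2.trans ht.2⟩)
  rw [log_neg_of_im_pos top, log_neg_of_im_neg bot] at e2
  have e4 : h s = h t := by simp only [hhdef, hγst]
  have e5 : G s = G t := by simp only [hGdef, hγst]
  rw [e4] at e1
  rw [e5] at e1
  have : (2 * Real.pi * I : ℂ) = 0 := by linear_combination -e1 - e2 - e3
  exact two_pi_I_ne_zero this

end Loop

section PathSpace

/-- Continuous planar paths started at the origin. -/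
abbrev PathSpace := {x : ℝ≥0 → ℂ // Continuous x ∧ x 0 = 0}

/-- The centred isotropic planar Gaussian measure with variance `d` in each direction. -/
noncomputable def gaussC (d : ℝ≥0) : Measure ℂ :=
  ((gaussianReal 0 d).prod (gaussianReal 0 d)).map fun p : ℝ × ℝ => equivRealProd.symm p

/-- The canonical filtration of the path space. -/
noncomputable def pastFiltration : Filtration ℝ≥0 (inferInstance : MeasurableSpace PathSpace) where
  seq s := MeasurableSpace.comap (fun x (u : Iic s) => x.1 u) inferInstance
  mono' s t hst := by
    have h : Measurable fun (y : Iic t → ℂ) (u : Iic s) => y ⟨u.1, u.2.trans hst⟩ :=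
      measurable_pi_lambda _ fun u => measurable_pi_apply _
    calc _ = MeasurableSpace.comap (fun (x : PathSpace) (u : Iic t) => x.1 u)
          (MeasurableSpace.comap (fun (y : Iic t → ℂ) (u : Iic s) => y ⟨u.1, u.2.trans hst⟩) inferInstance) :=
          MeasurableSpace.comap_comp.symm
      _ ≤ _ := MeasurableSpace.comap_mono h.comap_le
  le' s := by
    rw [← measurable_iff_comap_le]
    exact measurable_pi_lambda _ fun u => (measurable_pi_apply _).comp measurable_subtype_coe

@[fun_prop]
lemma measurable_eval (t : ℝ≥0) : Measurable fun x : PathSpace => x.1 t :=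
  (measurable_pi_apply t).comp measurable_subtype_coe

lemma measurable_past_eval {s t : ℝ≥0} (h : s ≤ t) :
    Measurable[pastFiltration t] fun x : PathSpace => x.1 s := by
  have : Measurable fun y : Iic t → ℂ => y ⟨s, h⟩ := measurable_pi_apply _
  exact this.comp (comap_measurable _)

lemma measurable_uncurry_eval : Measurable fun p : ℝ≥0 × PathSpace => p.2.1 p.1 :=
  measurable_uncurry_of_continuous_of_measurable (u := fun t (x : PathSpace) => x.1 t)
    (fun x => x.2.1) measurable_eval

lemma measurable_eval_comp {α : Type*} [MeasurableSpace α] {T : α → ℝ≥0} {X : α → PathSpace}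
    (hT : Measurable T) (hX : Measurable X) : Measurable fun a => (X a).1 (T a) :=
  measurable_uncurry_eval.comp (hT.prodMk hX)

/-- Measurability of maps into the path space is checked on coordinates. -/
lemma measurable_toPath {α : Type*} [MeasurableSpace α] {X : α → PathSpace}
    (h : ∀ t, Measurable fun a => (X a).1 t) : Measurable X :=
  Measurable.subtype_mk (h := fun a => (X a).2) (measurable_pi_lambda _ h)

lemma ext_of_map_val {μ ν : Measure PathSpace} (h : μ.map Subtype.val = ν.map Subtype.val) :
    μ = ν := by
  ext s hs
  obtain ⟨t, ht, rfl⟩ := hs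
  rw [← Measure.map_apply measurable_subtype_coe ht, h,
    Measure.map_apply measurable_subtype_coe ht]

/-- The path after time `s`, recentred. -/
def shift (s : ℝ≥0) (x : PathSpace) : PathSpace :=
  ⟨fun t => x.1 (s + t) - x.1 s, by have := x.2.1; fun_prop, by simp⟩

/-- Brownian scaling. -/
noncomputable def scale (c : ℝ≥0) (x : PathSpace) : PathSpace :=
  ⟨fun t => ((√(c : ℝ))⁻¹ : ℝ) • x.1 (c * t), by have := x.2.1; fun_prop, by simp [x.2.2]⟩

lemma measurable_shift_comp {α : Type*} [MeasurableSpace α] {T : α → ℝ≥0} {X : α → PathSpace}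
    (hT : Measurable T) (hX : Measurable X) : Measurable fun a => shift (T a) (X a) :=
  measurable_toPath fun t => (measurable_eval_comp (hT.add_const t) hX).sub
    (measurable_eval_comp hT hX)

lemma measurable_shift (s : ℝ≥0) : Measurable (shift s) :=
  measurable_shift_comp measurable_const measurable_id

lemma measurable_scale (c : ℝ≥0) : Measurable (scale c) :=
  measurable_toPath fun t => (measurable_eval (c * t)).const_smul (√(c : ℝ))⁻¹

/-- The law of planar Brownian motion started at the origin. -/
structure IsBM (ν : Measure PathSpace) : Prop where
  prob : IsProbabilityMeasure ν
  incr : ∀ s d : ℝ≥0, ν.map (fun x => x.1 (s + d) - x.1 s) = gaussC d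
  indep : ∀ s d : ℝ≥0,
    IndepFun (fun x => x.1 (s + d) - x.1 s) (fun x (u : Iic s) => x.1 u) ν

end PathSpace

section Uniqueness

lemma IsBM.integral_mul {ν : Measure PathSpace} (hν : IsBM ν) {s d : ℝ≥0} {f : ℂ → ℂ}
    (hf : Measurable f) {g : (Iic s → ℂ) → ℂ} (hg : Measurable g) :
    ∫ x, f (x.1 (s + d) - x.1 s) * g (fun u => x.1 u) ∂ν
      = (∫ z, f z ∂gaussC d) * ∫ x, g (fun u => x.1 u) ∂ν := by
  have h := (hν.indep s d).comp hf hg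
  have hm : Measurable fun x : PathSpace => fun u : Iic s => x.1 u :=
    measurable_pi_lambda _ fun u => measurable_eval _
  have := h.integral_fun_mul_eq_mul_integral
    (hf.comp (by fun_prop)).aestronglyMeasurable (hg.comp hm).aestronglyMeasurable
  simp only [Function.comp_apply] at this
  rw [this, ← hν.incr s d, integral_map (by fun_prop) hf.aestronglyMeasurable]

lemma IsBM.char_eq {μ ν : Measure PathSpace} (hμ : IsBM μ) (hν : IsBM ν) (J : Finset ℝ≥0) :
    ∀ ξ : ℝ≥0 → ℂ,
      ∫ x, exp ((∑ t ∈ J, ((ξ t).re * (x.1 t).re + (ξ t).im * (x.1 t).im) : ℝ) * I) ∂μ =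
      ∫ x, exp ((∑ t ∈ J, ((ξ t).re * (x.1 t).re + (ξ t).im * (x.1 t).im) : ℝ) * I) ∂ν := by
  have := hμ.prob
  have := hν.prob
  induction J using Finset.induction_on_max with
  | empty => simp
  | insert t J hJ ih =>
    intro ξ
    have htJ : t ∉ J := fun h => lt_irrefl _ (hJ t h)
    obtain ⟨s, hst, ξ', hs, hξ'⟩ : ∃ s ≤ t, ∃ ξ' : ℝ≥0 → ℂ, (∀ u ∈ J, u ≤ s) ∧
        ∀ x : PathSpace, ∑ u ∈ J, ((ξ u).re * (x.1 u).re + (ξ u).im * (x.1 u).im)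
          + ((ξ t).re * (x.1 s).re + (ξ t).im * (x.1 s).im) =
          ∑ u ∈ J, ((ξ' u).re * (x.1 u).re + (ξ' u).im * (x.1 u).im) := by
      rcases J.eq_empty_or_nonempty with rfl | hne
      · exact ⟨0, zero_le, ξ, by simp, fun x => by simp [x.2.2]⟩
      · refine ⟨J.max' hne, (hJ _ (J.max'_mem hne)).le,
          fun u => if u = J.max' hne then ξ u + ξ t else ξ u, fun u hu => J.le_max' u hu,
          fun x => ?_⟩
        have e : ∑ u ∈ J.erase (J.max' hne),
            ((if u = J.max' hne then ξ u + ξ t else ξ u).re * (x.1 u).re +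
            (if u = J.max' hne then ξ u + ξ t else ξ u).im * (x.1 u).im) =
            ∑ u ∈ J.erase (J.max' hne), ((ξ u).re * (x.1 u).re + (ξ u).im * (x.1 u).im) :=
          Finset.sum_congr rfl fun u hu => by rw [if_neg (Finset.ne_of_mem_erase hu)]
        rw [← Finset.add_sum_erase _ _ (J.max'_mem hne),
          ← Finset.add_sum_erase _ (fun u => _ * (x.1 u).re + _) (J.max'_mem hne), e]
        simp
        ring
    obtain ⟨d, rfl⟩ := exists_add_of_le hst
    have key : ∀ {ν : Measure PathSpace}, IsBM ν →
        ∫ x, exp ((∑ u ∈ insert (s + d) J,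
          ((ξ u).re * (x.1 u).re + (ξ u).im * (x.1 u).im) : ℝ) * I) ∂ν =
        (∫ z, exp (((ξ (s + d)).re * z.re + (ξ (s + d)).im * z.im : ℝ) * I) ∂gaussC d) *
        ∫ x, exp ((∑ u ∈ J, ((ξ' u).re * (x.1 u).re + (ξ' u).im * (x.1 u).im) : ℝ) * I) ∂ν := by
      intro ν hν
      have hgm : Measurable fun y : Iic s → ℂ => exp ((∑ u ∈ J.attach,
          ((ξ' u).re * (y ⟨u.1, hs u.1 u.2⟩).re + (ξ' u).im * (y ⟨u.1, hs u.1 u.2⟩).im) : ℝ) * I) := by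
        fun_prop
      have := hν.integral_mul (s := s) (d := d)
        (f := fun z => exp (((ξ (s + d)).re * z.re + (ξ (s + d)).im * z.im : ℝ) * I))
        (by fun_prop) hgm
      have hat : ∀ x : PathSpace, ∑ u ∈ J.attach, ((ξ' u).re * (x.1 u).re
          + (ξ' u).im * (x.1 u).im) = ∑ u ∈ J, ((ξ' u).re * (x.1 u).re + (ξ' u).im * (x.1 u).im) :=
        fun x => Finset.sum_attach J fun u => (ξ' u).re * (x.1 u).re + (ξ' u).im * (x.1 u).im
      simp only [hat] at this
      rw [← this]
      refine integral_congr_ae (.of_forall fun x => ?_)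
      simp only
      rw [Finset.sum_insert htJ, ← hξ', ← exp_add]
      congr 1
      push_cast [sub_re, sub_im]
      ring
    rw [key hμ, key hν, ih]

/-- Planar Wiener measure is unique. -/
theorem IsBM.unique {μ ν : Measure PathSpace} (hμ : IsBM μ) (hν : IsBM ν) : μ = ν := by
  have := hμ.prob
  have := hν.prob
  refine ext_of_map_val (IsProjectiveLimit.unique
    (P := fun J : Finset ℝ≥0 => (ν.map Subtype.val).map J.restrict) (fun J => ?_) fun J => rfl)
  have hm : Measurable fun x : PathSpace => J.restrict x.1 :=
    (Finset.measurable_restrict J).comp measurable_subtype_coe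
  refine Measure.ext_of_charFunDual (funext fun L => ?_)
  have hL : ∀ y : J → ℂ, L y = ∑ t, ((L (Pi.single t 1)) * (y t).re
      + (L (Pi.single t I)) * (y t).im) := by
    intro y
    conv_lhs => rw [← Finset.univ_sum_single y, map_sum]
    refine Finset.sum_congr rfl fun t _ => ?_
    have : (Pi.single t (y t) : J → ℂ) = (y t).re • (Pi.single t 1 : J → ℂ) + (y t).im • (Pi.single t I : J → ℂ) := by
      rw [← Pi.single_smul, ← Pi.single_smul, ← Pi.single_add]
      simp [re_add_im]
    rw [this, map_add, map_smul, map_smul, smul_eq_mul, smul_eq_mul]; ring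
  have key : ∀ {ν : Measure PathSpace}, charFunDual ((ν.map Subtype.val).map J.restrict) L =
      ∫ x, exp ((∑ t ∈ J.attach, (L (Pi.single t 1) * (x.1 t).re
        + L (Pi.single t I) * (x.1 t).im) : ℝ) * I) ∂ν := by
    intro ν
    rw [charFunDual_apply, Measure.map_map (Finset.measurable_restrict J) measurable_subtype_coe,
      integral_map (by exact hm.aemeasurable)
        (by exact Continuous.aestronglyMeasurable (by fun_prop))]
    refine integral_congr_ae (.of_forall fun x => ?_)
    simp only [Function.comp_apply]
    rw [hL]
    rfl
  classical
  have := hμ.char_eq hν J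
    (fun t => if h : t ∈ J then ⟨L (Pi.single ⟨t, h⟩ 1), L (Pi.single ⟨t, h⟩ I)⟩ else 0)
  simp only [← Finset.sum_attach J] at this
  rw [key, key]
  simpa using this

end Uniqueness

section Markov

variable {ν : Measure PathSpace}

lemma measurableSet_of_past {s : ℝ≥0} {A : Set PathSpace}
    (hA : MeasurableSet[pastFiltration s] A) : MeasurableSet A :=
  pastFiltration.le s _ hA

lemma measurable_equivRealProd_symm : Measurable fun p : ℝ × ℝ => equivRealProd.symm p :=
  measurableEquivRealProd.symm.measurable

instance (d : ℝ≥0) : IsProbabilityMeasure (gaussC d) :=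
  Measure.isProbabilityMeasure_map measurable_equivRealProd_symm.aemeasurable

lemma IsBM.measure_inter_incr (hν : IsBM ν) {s : ℝ≥0} (d : ℝ≥0) {A : Set PathSpace}
    (hA : MeasurableSet[pastFiltration s] A) {E : Set ℂ} (hE : MeasurableSet E) :
    ν (A ∩ (fun x => x.1 (s + d) - x.1 s) ⁻¹' E) = ν A * gaussC d E := by
  obtain ⟨A', hA', rfl⟩ := hA
  rw [inter_comm, (indepFun_iff_measure_inter_preimage_eq_mul.1 (hν.indep s d)) E A' hE hA',
    mul_comm, ← hν.incr s d, Measure.map_apply (by fun_prop) hE]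

lemma measurableSet_shift_preimage (s u : ℝ≥0) {A : Set PathSpace}
    (hA : MeasurableSet[pastFiltration u] A) :
    MeasurableSet[pastFiltration (s + u)] (shift s ⁻¹' A) := by
  obtain ⟨A', hA', rfl⟩ := hA
  rw [← preimage_comp]
  refine @measurable_pi_lambda _ _ _ (pastFiltration (s + u)) _ _ (fun v => ?_) _ hA'
  exact (measurable_past_eval (add_le_add_right v.2 s)).sub (measurable_past_eval le_self_add)

lemma indepFun_map_iff {Ω α β : Type*} {mΩ : MeasurableSpace Ω} {mα : MeasurableSpace α}
    {mβ : MeasurableSpace β} {P : Measure Ω}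
    {X : Ω → PathSpace} (hX : Measurable X) {f : PathSpace → α} (hf : Measurable f)
    {g : PathSpace → β} (hg : Measurable g) :
    IndepFun f g (P.map X) ↔ IndepFun (f ∘ X) (g ∘ X) P := by
  rw [indepFun_iff_measure_inter_preimage_eq_mul, indepFun_iff_measure_inter_preimage_eq_mul]
  refine forall₂_congr fun s t => forall₂_congr fun hs ht => ?_
  rw [Measure.map_apply hX ((hf hs).inter (hg ht)), Measure.map_apply hX (hf hs),
    Measure.map_apply hX (hg ht)]
  rfl

lemma measurable_past (s : ℝ≥0) : Measurable fun (x : PathSpace) (u : Iic s) => x.1 u :=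
  measurable_pi_lambda _ fun _ => measurable_eval _

/-- The simple Markov property. -/
theorem IsBM.markov (hν : IsBM ν) {s : ℝ≥0} {A C : Set PathSpace}
    (hA : MeasurableSet[pastFiltration s] A) (hC : MeasurableSet C) :
    ν (A ∩ shift s ⁻¹' C) = ν A * ν C := by
  have := hν.prob
  have hA' := measurableSet_of_past hA
  by_cases h0 : ν A = 0
  · rw [h0, zero_mul]
    exact measure_mono_null inter_subset_left h0
  have hcond := cond_isProbabilityMeasure h0
  have hinc : ∀ (u d : ℝ≥0) {E : Set ℂ} (_ : MeasurableSet E) {D : Set PathSpace}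
      (_ : MeasurableSet[pastFiltration u] D), (ν[|A]).map (shift s)
        ((fun x => x.1 (u + d) - x.1 u) ⁻¹' E ∩ D) =
        gaussC d E * (ν[|A]).map (shift s) D := by
    intro u d E hE D hD
    have hD' := measurableSet_of_past hD
    rw [Measure.map_apply (measurable_shift s) (((by fun_prop : Measurable
        fun x : PathSpace => x.1 (u + d) - x.1 u) hE).inter hD'),
      Measure.map_apply (measurable_shift s) hD', cond_apply hA', cond_apply hA']
    have h := hν.measure_inter_incr d (((pastFiltration.mono le_self_add) _ hA).inter
      (measurableSet_shift_preimage s u hD)) hE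
    have e : A ∩ shift s ⁻¹' ((fun x => x.1 (u + d) - x.1 u) ⁻¹' E ∩ D) =
        A ∩ shift s ⁻¹' D ∩ (fun x => x.1 (s + u + d) - x.1 (s + u)) ⁻¹' E := by
      ext x
      simp only [shift, mem_inter_iff, mem_preimage, sub_sub_sub_cancel_right, add_assoc]
      tauto
    rw [e, h]
    ring
  have hμ : IsBM ((ν[|A]).map (shift s)) := by
    have hp : IsProbabilityMeasure ((ν[|A]).map (shift s)) :=
      Measure.isProbabilityMeasure_map (measurable_shift s).aemeasurable
    have h1 : ∀ (u d : ℝ≥0) {E : Set ℂ} (_ : MeasurableSet E),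
        (ν[|A]).map (shift s) ((fun x => x.1 (u + d) - x.1 u) ⁻¹' E) = gaussC d E := by
      intro u d E hE
      simpa using hinc u d hE MeasurableSet.univ
    refine ⟨hp, fun u d => ?_, fun u d => ?_⟩
    · ext E hE
      rw [Measure.map_apply (by fun_prop) hE, h1 u d hE]
    · rw [indepFun_iff_measure_inter_preimage_eq_mul]
      intro E D hE hD
      rw [h1 u d hE, hinc u d hE ⟨D, hD, rfl⟩]
  have h := congrArg (· C) (hμ.unique hν)
  simp only [Measure.map_apply (measurable_shift s) hC, cond_apply hA'] at h
  rw [← h, ← mul_assoc, ENNReal.mul_inv_cancel h0 (measure_ne_top _ _), one_mul]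

lemma gaussC_map_smul (c d : ℝ≥0) (hc : c ≠ 0) :
    (gaussC (c * d)).map (fun z => ((√(c : ℝ))⁻¹ : ℝ) • z) = gaussC d := by
  have hr : (gaussianReal 0 (c * d)).map (fun z => (√(c : ℝ))⁻¹ * z) = gaussianReal 0 d := by
    rw [gaussianReal_map_const_mul, mul_zero]
    congr 1
    have hc' : (c : ℝ) ≠ 0 := by exact_mod_cast hc
    ext
    push_cast
    rw [inv_pow, Real.sq_sqrt (NNReal.coe_nonneg c)]
    field_simp
  have hm := measurable_equivRealProd_symm
  rw [gaussC, gaussC, Measure.map_map (by fun_prop) hm]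
  conv_rhs => rw [← hr, Measure.map_prod_map _ _ (by fun_prop) (by fun_prop),
    Measure.map_map hm (by fun_prop)]
  congr 1
  ext1 p
  simp only [Function.comp_apply, Prod.map]
  apply Complex.ext <;> simp [equivRealProd, -ofReal_inv, -real_smul, smul_re, smul_im]

theorem IsBM.map_scale (hν : IsBM ν) {c : ℝ≥0} (hc : c ≠ 0) : ν.map (scale c) = ν := by
  have := hν.prob
  refine IsBM.unique ⟨Measure.isProbabilityMeasure_map (measurable_scale c).aemeasurable,
    fun s d => ?_, fun s d => ?_⟩ hν
  · rw [Measure.map_map (by fun_prop) (measurable_scale c), ← gaussC_map_smul c d hc,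
      ← hν.incr (c * s) (c * d), Measure.map_map (by fun_prop) (by fun_prop)]
    congr 1
    ext1 x
    simp only [Function.comp_apply, scale, mul_add, smul_sub]
  · rw [indepFun_map_iff (measurable_scale c) (by fun_prop) (measurable_past s)]
    have h := (hν.indep (c * s) (c * d)).comp
      (φ := fun z => ((√(c : ℝ))⁻¹ : ℝ) • z)
      (ψ := fun (y : Iic (c * s) → ℂ) (u : Iic s) =>
        ((√(c : ℝ))⁻¹ : ℝ) • y ⟨c * u.1, mul_le_mul_right u.2 c⟩) (by fun_prop)
      (measurable_pi_lambda _ fun u => (measurable_pi_apply (X := fun _ : Iic (c * s) => ℂ) _).const_smul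
        (√(c : ℝ))⁻¹)
    refine h.congr (.of_forall fun x => ?_) (.of_forall fun x => rfl)
    simp only [Function.comp_apply, scale, mul_add, smul_sub]

end Markov

section OfPlanar

variable {Ω : Type*} [MeasurableSpace Ω]

/-- Every planar Brownian motion started at `w` is, almost surely, a translate of a path with
Wiener law. -/
theorem exists_path (BM : PlanarBM Ω) (w : ℂ) :
    ∃ X : Ω → PathSpace, Measurable X ∧ IsBM ((BM.P w).map X) ∧
      ∀ᵐ ω ∂BM.P w, (Continuous fun t => BM.Z t ω) ∧ ∀ t : ℝ≥0, BM.Z t ω = w + (X ω).1 t := by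
  classical
  have := BM.isProb w
  have hbad : ∀ᵐ ω ∂BM.P w, (Continuous fun t => BM.Z t ω) ∧ BM.Z 0 ω = w :=
    (BM.contPaths w).and (BM.start w)
  set N := toMeasurable (BM.P w) {ω | ¬((Continuous fun t => BM.Z t ω) ∧ BM.Z 0 ω = w)}
  have hN0 : BM.P w N = 0 := by rw [measure_toMeasurable]; exact hbad
  have hNm : MeasurableSet N := measurableSet_toMeasurable _ _
  have hNg : ∀ ω ∉ N, (Continuous fun t => BM.Z t ω) ∧ BM.Z 0 ω = w := fun ω hω => by
    by_contra h
    exact hω (subset_toMeasurable _ _ h)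
  let X : Ω → PathSpace := fun ω => ⟨fun t => if ω ∈ N then 0 else BM.Z t ω - w, by
    by_cases h : ω ∈ N
    · simp [h, continuous_const]
    · have := (hNg ω h).1
      simp only [h, if_false]
      fun_prop, by
    by_cases h : ω ∈ N
    · simp [h]
    · simp [h, (hNg ω h).2]⟩
  have hXm : Measurable X := measurable_toPath fun t =>
    Measurable.ite hNm measurable_const ((BM.meas t).sub_const w)
  have hXae : ∀ᵐ ω ∂BM.P w, (Continuous fun t => BM.Z t ω) ∧
      ∀ t : ℝ≥0, BM.Z t ω = w + (X ω).1 t := by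
    filter_upwards [measure_eq_zero_iff_ae_notMem.1 hN0] with ω hω
    exact ⟨(hNg ω hω).1, fun t => by simp [X, hω]⟩
  refine ⟨X, hXm, ⟨Measure.isProbabilityMeasure_map hXm.aemeasurable, fun s d => ?_,
    fun s d => ?_⟩, hXae⟩
  · rw [Measure.map_map (by fun_prop) hXm]
    have := BM.incrLaw w s (s + d : ℝ≥0) s.2 (by exact_mod_cast le_self_add)
    rw [NNReal.coe_add, add_sub_cancel_left, Real.toNNReal_coe] at this
    rw [gaussC, ← this]
    refine Measure.map_congr ?_
    filter_upwards [hXae] with ω hω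
    have h1 := hω.2 (s + d)
    have h2 := hω.2 s
    push_cast at h1
    simp only [Function.comp_apply]
    rw [h1, h2]
    ring
  · rw [indepFun_map_iff hXm (by fun_prop) (measurable_past s)]
    have h := (BM.indepIncr w s (s + d : ℝ≥0) s.2 (by exact_mod_cast le_self_add)).comp
      (φ := id) (ψ := fun (y : Iic (s : ℝ) → ℂ) (u : Iic s) => y ⟨u.1, u.2⟩ - w) measurable_id
      (measurable_pi_lambda _ fun u => (measurable_pi_apply _).sub_const _)
    refine h.congr ?_ ?_
    · filter_upwards [hXae] with ω hω
      simp only [Function.comp_apply, id]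
      rw [hω.2 (s + d), hω.2 s]
      ring
    · filter_upwards [hXae] with ω hω
      ext u
      simp only [Function.comp_apply]
      rw [hω.2 u]
      ring

end OfPlanar

section Stopping

/-- Finite stopping times of the canonical filtration. -/
def IsStop (T : PathSpace → ℝ≥0) : Prop := ∀ t, MeasurableSet[pastFiltration t] {x | T x ≤ t}

lemma IsStop.measurable {T : PathSpace → ℝ≥0} (hT : IsStop T) : Measurable T :=
  measurable_of_Iic fun t => measurableSet_of_past (hT t)

lemma IsStop.isStoppingTime {T : PathSpace → ℝ≥0} (hT : IsStop T) :
    IsStoppingTime pastFiltration fun x => (T x : WithTop ℝ≥0) := by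
  intro t
  simpa only [WithTop.coe_le_coe] using hT t

lemma IsStop.measurableSet_lt {T : PathSpace → ℝ≥0} (hT : IsStop T) (t : ℝ≥0) :
    MeasurableSet[pastFiltration t] {x | T x < t} := by
  simpa only [WithTop.coe_lt_coe] using hT.isStoppingTime.measurableSet_lt t

/-- The times reached by the discretisation at level `j`. -/
noncomputable def gridTime (j n : ℕ) : ℝ≥0 := (n + 1) / (j + 1)

/-- The index of the discretisation at level `j`. -/
noncomputable def gridIndex (j : ℕ) (t : ℝ≥0) : ℕ := ⌊(j + 1) * t⌋₊

lemma lt_gridTime (j : ℕ) (t : ℝ≥0) : t < gridTime j (gridIndex j t) := by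
  unfold gridTime gridIndex
  rw [lt_div_iff₀ (by positivity), mul_comm]
  exact Nat.lt_floor_add_one _

lemma gridTime_le (j : ℕ) (t : ℝ≥0) : gridTime j (gridIndex j t) ≤ t + 1 / (j + 1) := by
  unfold gridTime gridIndex
  have h := Nat.floor_le (zero_le (a := ((j : ℝ≥0) + 1) * t))
  have h' : (t + 1 / (j + 1)) * ((j : ℝ≥0) + 1) = (j + 1) * t + 1 := by
    field_simp
  rw [div_le_iff₀ (by positivity), h']
  gcongr

lemma tendsto_gridTime (t : ℝ≥0) :
    Tendsto (fun j => gridTime j (gridIndex j t)) atTop (𝓝 t) := by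
  refine tendsto_of_tendsto_of_tendsto_of_le_of_le tendsto_const_nhds ?_
    (fun j => (lt_gridTime j t).le) (fun j => gridTime_le j t)
  simpa using (tendsto_one_div_add_atTop_nhds_zero_nat (𝕜 := ℝ≥0)).const_add t

lemma measurable_gridIndex (j : ℕ) : Measurable (gridIndex j) :=
  Nat.measurable_floor.comp (measurable_const.mul measurable_id)

lemma IsStop.measurableSet_gridIndex {T : PathSpace → ℝ≥0} (hT : IsStop T) (j n : ℕ) :
    MeasurableSet[pastFiltration (gridTime j n)] {x | gridIndex j (T x) = n} := by
  have h : {x | gridIndex j (T x) = n} =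
      {x | T x < gridTime j n} \ {x | T x < n / (j + 1)} := by
    ext x
    have hj : (0 : ℝ≥0) < j + 1 := by positivity
    simp only [gridIndex, gridTime, mem_ofPred_eq, Set.mem_sdiff, not_lt, lt_div_iff₀ hj,
      Nat.floor_eq_iff (zero_le), mul_comm (T x)]
    tauto
  rw [h]
  refine (hT.measurableSet_lt _).diff (pastFiltration.mono ?_ _ (hT.measurableSet_lt _))
  unfold gridTime
  gcongr
  exact le_self_add

variable {ν : Measure PathSpace}

lemma IsBM.strong_markov_grid (hν : IsBM ν) {T : PathSpace → ℝ≥0} (hT : IsStop T) (j : ℕ)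
    {E : Set (ℝ≥0 × ℂ)} (hE : MeasurableSet E) {C : Set PathSpace} (hC : MeasurableSet C) :
    ν ((fun x => (gridTime j (gridIndex j (T x)), x.1 (gridTime j (gridIndex j (T x))))) ⁻¹' E ∩
      (fun x => shift (gridTime j (gridIndex j (T x))) x) ⁻¹' C) =
    ν ((fun x => (gridTime j (gridIndex j (T x)), x.1 (gridTime j (gridIndex j (T x))))) ⁻¹' E)
      * ν C := by
  set A : ℕ → Set PathSpace := fun n =>
    {x | gridIndex j (T x) = n} ∩ (fun x => (gridTime j n, x.1 (gridTime j n))) ⁻¹' E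
  have hA : ∀ n, MeasurableSet[pastFiltration (gridTime j n)] (A n) := fun n =>
    (hT.measurableSet_gridIndex j n).inter
      ((measurable_const.prodMk (measurable_past_eval le_rfl)) hE)
  have hdisj : Pairwise (Function.onFun Disjoint A) := by
    intro m n hmn
    refine Set.disjoint_left.2 fun x hx hy => hmn (hx.1.symm.trans hy.1)
  have e1 : (fun x : PathSpace => (gridTime j (gridIndex j (T x)),
      x.1 (gridTime j (gridIndex j (T x))))) ⁻¹' E = ⋃ n, A n := by
    ext x; simp [A]
  have e2 : (⋃ n, A n) ∩ (fun x => shift (gridTime j (gridIndex j (T x))) x) ⁻¹' C =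
      ⋃ n, (A n ∩ shift (gridTime j n) ⁻¹' C) := by
    ext x; simp [A]
  rw [e1, e2, measure_iUnion hdisj fun n => measurableSet_of_past (hA n),
    measure_iUnion (fun m n hmn => (hdisj hmn).mono inter_subset_left inter_subset_left)
      fun n => (measurableSet_of_past (hA n)).inter (measurable_shift _ hC), ← ENNReal.tsum_mul_right]
  exact tsum_congr fun n => hν.markov (hA n) hC

/-- The strong Markov property. -/
theorem IsBM.strong_markov (hν : IsBM ν) {T : PathSpace → ℝ≥0} (hT : IsStop T) :
    ν.map (fun x => ((T x, x.1 (T x)), shift (T x) x)) =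
      (ν.map fun x => (T x, x.1 (T x))).prod ν := by
  have := hν.prob
  have hTm := hT.measurable
  have hgm : ∀ j, Measurable fun x => gridTime j (gridIndex j (T x)) := fun j =>
    (measurable_from_nat (f := gridTime j)).comp ((measurable_gridIndex j).comp hTm)
  have hpm : ∀ {S : PathSpace → ℝ≥0}, Measurable S → Measurable fun x => (S x, x.1 (S x)) :=
    fun hS => hS.prodMk (measurable_eval_comp hS measurable_id)
  have hsm : ∀ {S : PathSpace → ℝ≥0}, Measurable S → Measurable fun x => shift (S x) x :=
    fun hS => measurable_shift_comp hS measurable_id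
  have hgrid : ∀ (J : Finset ℝ≥0) (f : ℝ≥0 × ℂ →ᵇ ℝ) (g : (J → ℂ) →ᵇ ℝ) (j : ℕ),
      ∫ x, f (gridTime j (gridIndex j (T x)), x.1 (gridTime j (gridIndex j (T x)))) *
        g (fun t => (shift (gridTime j (gridIndex j (T x))) x).1 t) ∂ν =
      (∫ x, f (gridTime j (gridIndex j (T x)), x.1 (gridTime j (gridIndex j (T x)))) ∂ν) *
        ∫ x, g (fun t => x.1 t) ∂ν := by
    intro J f g j
    have hind : IndepFun (fun x : PathSpace => (gridTime j (gridIndex j (T x)),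
        x.1 (gridTime j (gridIndex j (T x)))))
        (fun x => shift (gridTime j (gridIndex j (T x))) x) ν := by
      rw [indepFun_iff_measure_inter_preimage_eq_mul]
      intro E C hE hC
      rw [hν.strong_markov_grid hT j hE hC]
      congr 1
      simpa using (hν.strong_markov_grid hT j MeasurableSet.univ hC).symm
    have hlaw : ν.map (fun x => shift (gridTime j (gridIndex j (T x))) x) = ν := by
      ext C hC
      rw [Measure.map_apply (hsm (hgm j)) hC]
      simpa using hν.strong_markov_grid hT j MeasurableSet.univ hC
    have hgm' : Measurable fun x : PathSpace => g (fun t : J => x.1 t) :=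
      g.continuous.measurable.comp (measurable_pi_lambda _ fun t => measurable_eval _)
    have h := (hind.comp f.continuous.measurable hgm').integral_fun_mul_eq_mul_integral
      (f.continuous.measurable.comp (hpm (hgm j))).aestronglyMeasurable
      (hgm'.comp (hsm (hgm j))).aestronglyMeasurable
    simp only [Function.comp_apply] at h
    rw [h]
    congr 1
    conv_rhs => rw [← hlaw, integral_map (hsm (hgm j)).aemeasurable hgm'.aestronglyMeasurable]
  have hlim : ∀ (J : Finset ℝ≥0) (f : ℝ≥0 × ℂ →ᵇ ℝ) (g : (J → ℂ) →ᵇ ℝ),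
      ∫ x, f (T x, x.1 (T x)) * g (fun t => (shift (T x) x).1 t) ∂ν =
      (∫ x, f (T x, x.1 (T x)) ∂ν) * ∫ x, g (fun t => x.1 t) ∂ν := by
    intro J f g
    have hfm : ∀ {S : PathSpace → ℝ≥0}, Measurable S → Measurable fun x => f (S x, x.1 (S x)) :=
      fun hS => f.continuous.measurable.comp (hpm hS)
    have hgm' : ∀ {S : PathSpace → ℝ≥0}, Measurable S →
        Measurable fun x => g (fun t => (shift (S x) x).1 t) := fun hS =>
      g.continuous.measurable.comp
        (measurable_pi_lambda _ fun t => (measurable_eval _).comp (hsm hS))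
    have hft : ∀ x : PathSpace, Tendsto (fun j => f (gridTime j (gridIndex j (T x)),
        x.1 (gridTime j (gridIndex j (T x))))) atTop (𝓝 (f (T x, x.1 (T x)))) := fun x =>
      (f.continuous.tendsto _).comp ((tendsto_gridTime (T x)).prodMk_nhds
        ((x.2.1.tendsto _).comp (tendsto_gridTime (T x))))
    have hgt : ∀ x : PathSpace, Tendsto (fun j =>
        g (fun t => (shift (gridTime j (gridIndex j (T x))) x).1 t)) atTop
        (𝓝 (g (fun t => (shift (T x) x).1 t))) := fun x => by
      refine (g.continuous.tendsto _).comp (tendsto_pi_nhds.2 fun t => ?_)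
      exact ((x.2.1.tendsto _).comp ((tendsto_gridTime (T x)).add_const _)).sub
        ((x.2.1.tendsto _).comp (tendsto_gridTime (T x)))
    have l1 := tendsto_integral_of_dominated_convergence (μ := ν) (fun _ => ‖f‖ * ‖g‖)
      (fun j => ((hfm (hgm j)).mul (hgm' (hgm j))).aestronglyMeasurable) (integrable_const _)
      (fun j => .of_forall fun x => by
        rw [Pi.mul_apply, norm_mul]; gcongr
        · exact f.norm_coe_le_norm _
        · exact g.norm_coe_le_norm _) (.of_forall fun x => (hft x).mul (hgt x))
    have l2 := tendsto_integral_of_dominated_convergence (μ := ν) (fun _ => ‖f‖)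
      (fun j => (hfm (hgm j)).aestronglyMeasurable) (integrable_const _)
      (fun j => .of_forall fun x => f.norm_coe_le_norm _) (.of_forall fun x => hft x)
    refine tendsto_nhds_unique l1 ?_
    refine (l2.mul_const (∫ x, g (fun t => x.1 t) ∂ν)).congr fun j => ?_
    exact (hgrid J f g j).symm
  have hlaw : ν.map (fun x => shift (T x) x) = ν := by
    refine ext_of_map_val (IsProjectiveLimit.unique
      (P := fun J : Finset ℝ≥0 => (ν.map Subtype.val).map J.restrict) (fun J => ?_) fun J => rfl)
    have hm : Measurable (J.restrict (π := fun _ : ℝ≥0 => ℂ) ∘ (Subtype.val : PathSpace → _)) :=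
      (Finset.measurable_restrict J).comp measurable_subtype_coe
    refine ext_of_forall_integral_eq_of_IsFiniteMeasure fun g => ?_
    beta_reduce
    rw [Measure.map_map measurable_subtype_coe (hsm hTm),
      Measure.map_map (Finset.measurable_restrict J) (measurable_subtype_coe.comp (hsm hTm)),
      Measure.map_map (Finset.measurable_restrict J) measurable_subtype_coe,
      ← Function.comp_assoc,
      integral_map (hm.comp (hsm hTm)).aemeasurable g.continuous.aestronglyMeasurable,
      integral_map hm.aemeasurable g.continuous.aestronglyMeasurable]
    have := hlim J (BoundedContinuousFunction.const _ 1) g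
    simp only [BoundedContinuousFunction.const_apply, one_mul, integral_const, probReal_univ,
      smul_eq_mul] at this
    exact this
  have hind : IndepFun (fun x : PathSpace => (T x, x.1 (T x)))
      (fun x (t : ℝ≥0) => (shift (T x) x).1 t) ν := by
    refine IndepFun.indepFun_process (hpm hTm) (fun t => (measurable_eval t).comp (hsm hTm))
      fun J => ?_
    refine indepFun_pi_of_bcf (hpm hTm).aemeasurable
      (fun t => ((measurable_eval _).comp (hsm hTm)).aemeasurable) fun f g => ?_
    rw [hlim J f g]
    have := hlim J (BoundedContinuousFunction.const _ 1) g
    simp only [BoundedContinuousFunction.const_apply, one_mul, integral_const, probReal_univ,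
      smul_eq_mul, mul_one] at this
    rw [this]
    rfl
  have hind' : IndepFun (fun x : PathSpace => (T x, x.1 (T x))) (fun x => shift (T x) x) ν := by
    rw [indepFun_iff_measure_inter_preimage_eq_mul] at hind ⊢
    rintro E _ hE ⟨C, hC, rfl⟩
    exact hind E C hE hC
  rw [(indepFun_iff_map_prod_eq_prod_map_map (hpm hTm).aemeasurable (hsm hTm).aemeasurable).1 hind',
    hlaw]

end Stopping

section Hitting

/-- The hitting time of `C`, capped at `N`. -/
noncomputable def capHit (C : Set ℂ) (N : ℝ≥0) (x : PathSpace) : ℝ≥0 :=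
  sInf ({t | x.1 t ∈ C} ∪ {N})

variable {C : Set ℂ} {N t : ℝ≥0} {x : PathSpace}

lemma capHit_le : capHit C N x ≤ N := csInf_le (OrderBot.bddBelow _) (Or.inr rfl)

lemma capHit_le_of_mem (h : x.1 t ∈ C) : capHit C N x ≤ t :=
  csInf_le (OrderBot.bddBelow _) (Or.inl h)

lemma notMem_of_lt_capHit (h : t < capHit C N x) : x.1 t ∉ C := fun ht =>
  h.not_ge (capHit_le_of_mem ht)

lemma capHit_mem (hC : IsClosed C) : capHit C N x ∈ {t | x.1 t ∈ C} ∪ {N} :=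
  ((hC.preimage x.2.1).union isClosed_singleton).csInf_mem ⟨N, Or.inr rfl⟩ (OrderBot.bddBelow _)

lemma capHit_le_iff (hC : IsClosed C) :
    capHit C N x ≤ t ↔ N ≤ t ∨ ∃ s ≤ t, x.1 s ∈ C := by
  constructor
  · intro h
    rcases capHit_mem (N := N) (x := x) hC with h' | h'
    · exact Or.inr ⟨_, h, h'⟩
    · exact Or.inl (h'.symm.le.trans h)
  · rintro (h | ⟨s, hs, hx⟩)
    · exact capHit_le.trans h
    · exact (capHit_le_of_mem hx).trans hs

lemma measurableSet_exists_le_mem {α : Type*} [MeasurableSpace α] {Y : α → ℝ≥0 → ℂ}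
    (hY : ∀ a, Continuous (Y a)) (hC : IsClosed C) {t : ℝ≥0}
    (hm : ∀ s ≤ t, Measurable fun a => Y a s) : MeasurableSet {a | ∃ s ≤ t, Y a s ∈ C} := by
  rcases C.eq_empty_or_nonempty with rfl | hne
  · simp
  have : Nonempty (Iic t) := ⟨⟨t, mem_Iic.2 le_rfl⟩⟩
  have h : {a | ∃ s ≤ t, Y a s ∈ C} = ⋂ n : ℕ, ⋃ k : ℕ,
      {a | Metric.infDist (Y a (TopologicalSpace.denseSeq (Iic t) k)) C < 1 / ((n : ℝ) + 1)} := by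
    ext a
    simp only [mem_ofPred_eq, mem_iInter, mem_iUnion]
    constructor
    · rintro ⟨s, hs, ha⟩ n
      have ho : IsOpen {u : Iic t | Metric.infDist (Y a u) C < 1 / ((n : ℝ) + 1)} :=
        isOpen_lt ((Metric.continuous_infDist_pt C).comp ((hY a).comp continuous_subtype_val))
          continuous_const
      obtain ⟨_, hu, k, rfl⟩ := (TopologicalSpace.denseRange_denseSeq (Iic t)).inter_open_nonempty _
        ho ⟨⟨s, hs⟩, by
          show Metric.infDist (Y a s) C < _
          rw [Metric.infDist_zero_of_mem ha]; positivity⟩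
      exact ⟨k, hu⟩
    · intro h
      obtain ⟨s, hs, hmin⟩ := (isCompact_Icc (a := (0 : ℝ≥0)) (b := t)).exists_isMinOn
        ⟨t, zero_le, le_rfl⟩ ((Metric.continuous_infDist_pt C).comp (hY a)).continuousOn
      refine ⟨s, hs.2, (hC.mem_iff_infDist_zero hne).2 ?_⟩
      by_contra h0
      obtain ⟨n, hn⟩ := exists_nat_one_div_lt (lt_of_le_of_ne Metric.infDist_nonneg (Ne.symm h0))
      obtain ⟨k, hk⟩ := h n
      have := hmin (a := TopologicalSpace.denseSeq (Iic t) k)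
        ⟨zero_le, (TopologicalSpace.denseSeq (Iic t) k).2⟩
      simp only [Function.comp_apply, mem_ofPred_eq] at this
      linarith
  rw [h]
  refine MeasurableSet.iInter fun n => MeasurableSet.iUnion fun k => ?_
  exact measurableSet_lt ((Metric.continuous_infDist_pt C).measurable.comp
    (hm _ (TopologicalSpace.denseSeq (Iic t) k).2)) measurable_const

lemma measurableSet_exists_mem (hC : IsClosed C) (t : ℝ≥0) :
    MeasurableSet[pastFiltration t] {x : PathSpace | ∃ s ≤ t, x.1 s ∈ C} :=
  @measurableSet_exists_le_mem _ _ (pastFiltration t) (fun x : PathSpace => x.1)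
    (fun x => x.2.1) hC _ fun _ hs => measurable_past_eval hs

lemma isStop_capHit (hC : IsClosed C) (N : ℝ≥0) : IsStop (capHit C N) := by
  intro t
  have h : {x : PathSpace | capHit C N x ≤ t} = {_x | N ≤ t} ∪ {x | ∃ s ≤ t, x.1 s ∈ C} := by
    ext x; simp [capHit_le_iff hC]
  rw [h]
  exact (MeasurableSet.const _).union (measurableSet_exists_mem hC t)

lemma measurable_capHit (hC : IsClosed C) (N : ℝ≥0) : Measurable (capHit C N) :=
  (isStop_capHit hC N).measurable

end Hitting

section OptionalStopping

variable {ν : Measure PathSpace}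

lemma IsBM.integral_strong_markov {E : Type*} [NormedAddCommGroup E] [NormedSpace ℝ E]
    (hν : IsBM ν) {T : PathSpace → ℝ≥0} (hT : IsStop T)
    {F : (ℝ≥0 × ℂ) × PathSpace → E} (hF : StronglyMeasurable F)
    (hi : Integrable (fun x => F ((T x, x.1 (T x)), shift (T x) x)) ν) :
    Integrable (fun x => ∫ w, F ((T x, x.1 (T x)), w) ∂ν) ν ∧
    ∫ x, F ((T x, x.1 (T x)), shift (T x) x) ∂ν = ∫ x, ∫ w, F ((T x, x.1 (T x)), w) ∂ν ∂ν := by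
  have := hν.prob
  have hp : Measurable fun x : PathSpace => (T x, x.1 (T x)) :=
    hT.measurable.prodMk (measurable_eval_comp hT.measurable measurable_id)
  have hm : Measurable fun x => ((T x, x.1 (T x)), shift (T x) x) :=
    hp.prodMk (measurable_shift_comp hT.measurable measurable_id)
  have hprob : IsProbabilityMeasure (ν.map fun x : PathSpace => (T x, x.1 (T x))) :=
    Measure.isProbabilityMeasure_map hp.aemeasurable
  have hi' : Integrable F ((ν.map fun x => (T x, x.1 (T x))).prod ν) := by
    rw [← hν.strong_markov hT]
    exact (integrable_map_measure hF.aestronglyMeasurable hm.aemeasurable).2 hi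
  have hs : StronglyMeasurable fun p => ∫ w, F (p, w) ∂ν := hF.integral_prod_right'
  have h1 := hi'.integral_prod_left
  have h2 := integral_prod _ hi'
  rw [← hν.strong_markov hT, integral_map hm.aemeasurable hF.aestronglyMeasurable,
    integral_map hp.aemeasurable hs.aestronglyMeasurable] at h2
  exact ⟨(integrable_map_measure hs.aestronglyMeasurable
    hp.aemeasurable).1 h1, h2⟩

lemma IsBM.map_eval (hν : IsBM ν) (t : ℝ≥0) : ν.map (fun x => x.1 t) = gaussC t := by
  rw [← hν.incr 0 t]
  congr 1
  ext1 x
  simp [x.2.2]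

/-- The exponential martingale. -/
noncomputable def expMart (a b : ℂ) (t : ℝ≥0) (z : ℂ) : ℂ :=
  exp (a * z.re + b * z.im - (a ^ 2 + b ^ 2) * t / 2)

lemma measurable_expMart (a b : ℂ) : Measurable fun p : ℝ≥0 × ℂ => expMart a b p.1 p.2 := by
  unfold expMart
  fun_prop

lemma expMart_add (a b : ℂ) (s t : ℝ≥0) (z w : ℂ) :
    expMart a b (s + t) (z + w) = expMart a b s z * expMart a b t w := by
  unfold expMart
  rw [← exp_add]
  congr 1
  simp only [add_re, add_im]
  push_cast
  ring

lemma integral_exp_gaussianReal (a : ℂ) (t : ℝ≥0) :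
    ∫ x : ℝ, exp (a * x) ∂gaussianReal 0 t = exp (t * a ^ 2 / 2) := by
  have := complexMGF_id_gaussianReal (μ := 0) (v := t) a
  simpa [complexMGF] using this

lemma IsBM.integral_expMart (hν : IsBM ν) (a b : ℂ) (t : ℝ≥0) :
    ∫ x, expMart a b t (x.1 t) ∂ν = 1 := by
  have hm : Measurable (expMart a b t) := (measurable_expMart a b).comp measurable_prodMk_left
  rw [← integral_map (φ := fun x : PathSpace => x.1 t) (measurable_eval t).aemeasurable
    hm.aestronglyMeasurable, hν.map_eval, gaussC,
    integral_map measurable_equivRealProd_symm.aemeasurable hm.aestronglyMeasurable]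
  have h : ∀ p : ℝ × ℝ, expMart a b t (equivRealProd.symm p) =
      exp (-((a ^ 2 + b ^ 2) * t / 2)) * (exp (a * p.1) * exp (b * p.2)) := by
    intro p
    rw [← exp_add, ← exp_add, expMart]
    congr 1
    simp [equivRealProd_symm_apply]
    ring
  simp only [h]
  rw [integral_const_mul, integral_prod_mul (f := fun x : ℝ => exp (a * x))
    (g := fun x : ℝ => exp (b * x)), integral_exp_gaussianReal, integral_exp_gaussianReal,
    ← exp_add, ← exp_add, ← exp_zero]
  congr 1
  ring

variable {T : PathSpace → ℝ≥0} {N : ℝ≥0}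

lemma eval_eq_add_shift {s t : ℝ≥0} (h : s ≤ t) (x : PathSpace) :
    x.1 t = x.1 s + (shift s x).1 (t - s) := by
  simp [shift, add_tsub_cancel_of_le h]

/-- Optional stopping for the exponential martingale. -/
theorem IsBM.integral_expMart_stop (hν : IsBM ν) (hT : IsStop T) (hN : ∀ x, T x ≤ N) (a b : ℂ) :
    ∫ x, expMart a b (T x) (x.1 (T x)) ∂ν = 1 := by
  set F : (ℝ≥0 × ℂ) × PathSpace → ℂ := fun p =>
    expMart a b p.1.1 p.1.2 * expMart a b (N - p.1.1) (p.2.1 (N - p.1.1))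
  have hF : Measurable F := by
    have h0 : Measurable fun p : (ℝ≥0 × ℂ) × PathSpace => N - p.1.1 := by fun_prop
    exact ((measurable_expMart a b).comp measurable_fst).mul
      ((measurable_expMart a b).comp (h0.prodMk (measurable_eval_comp h0 measurable_snd)))
  have hFe : ∀ x, F ((T x, x.1 (T x)), shift (T x) x) = expMart a b N (x.1 N) := by
    intro x
    simp only [F]
    rw [eval_eq_add_shift (hN x), ← expMart_add, add_tsub_cancel_of_le (hN x)]
  have h1 := hν.integral_expMart a b N
  have hi : Integrable (fun x => expMart a b N (x.1 N)) ν :=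
    not_imp_comm.1 integral_undef (h1.trans_ne one_ne_zero)
  have h2 := (hν.integral_strong_markov hT hF.stronglyMeasurable (by simpa only [hFe] using hi)).2
  simp only [hFe, h1, F, integral_const_mul, hν.integral_expMart, mul_one] at h2
  exact h2.symm

lemma IsBM.integrable_expMart_stop (hν : IsBM ν) (hT : IsStop T) (hN : ∀ x, T x ≤ N) (a b : ℂ) :
    Integrable (fun x => expMart a b (T x) (x.1 (T x))) ν :=
  not_imp_comm.1 integral_undef ((hν.integral_expMart_stop hT hN a b).trans_ne one_ne_zero)

lemma IsBM.integrable_im (hν : IsBM ν) (t : ℝ≥0) :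
    Integrable (fun x => (x.1 t).im) ν ∧ ∫ x, (x.1 t).im ∂ν = 0 := by
  have hi : Integrable (fun p : ℝ × ℝ => p.2) ((gaussianReal 0 t).prod (gaussianReal 0 t)) :=
    ((memLp_id_gaussianReal 1).integrable le_rfl).comp_snd _
  have hm : Measurable fun p : ℝ × ℝ => (equivRealProd.symm p : ℂ) := measurable_equivRealProd_symm
  have hi' : Integrable (fun z : ℂ => z.im) (gaussC t) := by
    rw [gaussC, integrable_map_measure measurable_im.aestronglyMeasurable hm.aemeasurable]
    exact hi
  have e : ∫ z : ℂ, z.im ∂gaussC t = 0 := by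
    rw [gaussC, integral_map hm.aemeasurable measurable_im.aestronglyMeasurable]
    simp only [equivRealProd_symm_apply]
    have := integral_prod _ hi
    simpa [integral_id_gaussianReal] using this
  rw [← hν.map_eval t] at hi' e
  refine ⟨(integrable_map_measure measurable_im.aestronglyMeasurable
    (measurable_eval t).aemeasurable).1 hi', ?_⟩
  rwa [integral_map (measurable_eval t).aemeasurable measurable_im.aestronglyMeasurable] at e

/-- Optional stopping for the imaginary part. -/
theorem IsBM.integrable_im_stop (hν : IsBM ν) (hT : IsStop T) (hN : ∀ x, T x ≤ N) :
    Integrable (fun x => (x.1 (T x)).im) ν ∧ ∫ x, (x.1 (T x)).im ∂ν = 0 := by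
  have := hν.prob
  set F : (ℝ≥0 × ℂ) × PathSpace → ℝ := fun p => p.1.2.im + (p.2.1 (N - p.1.1)).im
  have hF : Measurable F := by
    have h0 : Measurable fun p : (ℝ≥0 × ℂ) × PathSpace => N - p.1.1 := by fun_prop
    exact (measurable_im.comp (measurable_snd.comp measurable_fst)).add
      (measurable_im.comp (measurable_eval_comp h0 measurable_snd))
  have hFe : ∀ x, F ((T x, x.1 (T x)), shift (T x) x) = (x.1 N).im := by
    intro x
    rw [eval_eq_add_shift (hN x)]
    rfl
  have hFi : ∀ p, ∫ w, F (p, w) ∂ν = p.2.im := by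
    intro p
    simp only [F]
    rw [integral_add (integrable_const _) (hν.integrable_im _).1, (hν.integrable_im _).2]
    simp
  have h := hν.integral_strong_markov hT hF.stronglyMeasurable
    (by simpa only [hFe] using (hν.integrable_im N).1)
  simp only [hFe, hFi, (hν.integrable_im N).2] at h
  exact ⟨h.1, h.2.symm⟩

end OptionalStopping

section Cauchy

lemma integrable_exp_mul_abs {r : ℝ} (hr : r < 0) (w : ℝ) :
    Integrable (fun v : ℝ => exp (w * v * I + r * |v|)) ∧
    ∫ v : ℝ, exp (w * v * I + r * |v|) = -(r + w * I)⁻¹ - (r - w * I)⁻¹ := by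
  have e1 : EqOn (fun v : ℝ => exp (w * v * I + r * |v|)) (fun v : ℝ => exp ((r + w * I) * v))
      (Ioi 0) := by
    intro v hv
    simp only [abs_of_pos (mem_Ioi.1 hv)]
    congr 1; ring
  have e2 : EqOn (fun v : ℝ => exp (w * v * I + r * |v|)) (fun v : ℝ => exp ((-r + w * I) * v))
      (Iic 0) := by
    intro v hv
    simp only [abs_of_nonpos (mem_Iic.1 hv)]
    congr 1; push_cast; ring
  have h1 : ((r : ℂ) + w * I).re < 0 := by simpa
  have h2 : 0 < (-(r : ℂ) + w * I).re := by simpa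
  have i1 := (integrableOn_congr_fun e1 measurableSet_Ioi).2 (integrableOn_exp_mul_complex_Ioi h1 0)
  have i2 := (integrableOn_congr_fun e2 measurableSet_Iic).2 (integrableOn_exp_mul_complex_Iic h2 0)
  refine ⟨?_, ?_⟩
  · rw [← integrableOn_univ, ← Iic_union_Ioi (a := (0 : ℝ))]
    exact i2.union i1
  · rw [← intervalIntegral.integral_Iic_add_Ioi i2 i1, setIntegral_congr_fun measurableSet_Iic e2,
      setIntegral_congr_fun measurableSet_Ioi e1, integral_exp_mul_complex_Iic h2,
      integral_exp_mul_complex_Ioi h1]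
    have : (-(r : ℂ) + w * I) = -(r - w * I) := by ring
    rw [this, ofReal_zero, mul_zero, mul_zero, exp_zero, div_neg, neg_div, one_div, one_div]
    ring

lemma fourier_exp_abs {γ : ℝ≥0} (hγ : γ ≠ 0) (w : ℝ) :
    𝓕 (fun v : ℝ => exp ((-(2 * Real.pi * γ) : ℝ) * |v|)) w = (cauchyPDFReal 0 γ w : ℂ) := by
  have hγ' : (0 : ℝ) < γ := by positivity
  have hr : -(2 * Real.pi * γ) < 0 := by have := Real.pi_pos; nlinarith [mul_pos this hγ']
  rw [Real.fourier_real_eq_integral_exp_smul]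
  have h := (integrable_exp_mul_abs hr (-2 * Real.pi * w)).2
  refine (integral_congr_ae (.of_forall fun v => ?_)).trans (h.trans ?_)
  · simp only [smul_eq_mul]
    rw [← exp_add]
    congr 1
    push_cast; ring
  · have hp : (Real.pi : ℂ) ≠ 0 := by exact_mod_cast Real.pi_ne_zero
    have h1 : ((γ : ℝ) : ℂ) + w * I ≠ 0 := fun h => by
      have := congrArg re h; simp at this; exact hγ this
    have h2 : ((γ : ℝ) : ℂ) - w * I ≠ 0 := fun h => by
      have := congrArg re h; simp at this; exact hγ this
    have h3 : ((w : ℂ) ^ 2 + ((γ : ℝ) : ℂ) ^ 2) = (γ + w * I) * (γ - w * I) := by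
      linear_combination (w : ℂ) ^ 2 * I_sq
    have h4 : (((-(2 * Real.pi * γ) : ℝ) : ℂ) + ((-2 * Real.pi * w : ℝ) : ℂ) * I)
        = -(2 * Real.pi) * (γ + w * I) := by push_cast; ring
    have h5 : (((-(2 * Real.pi * γ) : ℝ) : ℂ) - ((-2 * Real.pi * w : ℝ) : ℂ) * I)
        = -(2 * Real.pi) * (γ - w * I) := by push_cast; ring
    rw [h4, h5, cauchyPDFReal_def]
    push_cast
    rw [sub_zero, h3]
    field_simp
    ring

lemma charFun_cauchyMeasure {γ : ℝ≥0} (hγ : γ ≠ 0) (t : ℝ) :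
    charFun (cauchyMeasure 0 γ) t = exp ((-(γ * |t|) : ℝ)) := by
  have hγ' : (0 : ℝ) < γ := by positivity
  have hr : -(2 * Real.pi * γ) < 0 := by have := Real.pi_pos; nlinarith [mul_pos this hγ']
  set g : ℝ → ℂ := fun v => exp ((-(2 * Real.pi * γ) : ℝ) * |v|) with hg
  have hF : 𝓕 g = fun w => (cauchyPDFReal 0 γ w : ℂ) := funext (fourier_exp_abs hγ)
  have hgi : Integrable g := by
    have := (integrable_exp_mul_abs hr 0).1
    simpa only [ofReal_zero, zero_mul, zero_add] using this
  have hinv := congrFun (Continuous.fourierInv_fourier_eq (f := g) (by fun_prop) hgi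
    (by rw [hF]; exact (integrable_cauchyPDFReal 0).ofReal)) (t / (2 * Real.pi))
  rw [Real.fourierInv_eq', hF] at hinv
  rw [charFun_apply_real, cauchyMeasure_of_scale_ne_zero 0 hγ,
    integral_withDensity_eq_integral_toReal_smul (by fun_prop)
    (.of_forall fun x => by simp [cauchyPDF])]
  refine (integral_congr_ae (.of_forall fun x => ?_)).trans (hinv.trans ?_)
  · simp only [cauchyPDF]
    rw [ENNReal.toReal_ofReal (cauchyPDF_pos 0 hγ x).le, smul_eq_mul, real_smul,
      mul_comm]
    congr 2
    simp
    field_simp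
  · simp only [hg]
    rw [abs_div, abs_of_pos (by positivity : 0 < 2 * Real.pi)]
    push_cast
    have hp : (Real.pi : ℂ) ≠ 0 := by exact_mod_cast Real.pi_ne_zero
    field_simp

end Cauchy

section UncappedHitting

/-- The hitting time of `C`, equal to `0` when `C` is never hit. -/
noncomputable def hit (C : Set ℂ) (x : PathSpace) : ℝ≥0 := sInf {t | x.1 t ∈ C}

variable {C : Set ℂ} {N t : ℝ≥0} {x : PathSpace}

lemma hit_mem (hC : IsClosed C) (h : ∃ t, x.1 t ∈ C) : x.1 (hit C x) ∈ C :=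
  (hC.preimage x.2.1).csInf_mem h (OrderBot.bddBelow _)

lemma hit_le (h : x.1 t ∈ C) : hit C x ≤ t := csInf_le (OrderBot.bddBelow _) h

lemma capHit_eq_hit (h : x.1 t ∈ C) (ht : t ≤ N) : capHit C N x = hit C x := by
  refine le_antisymm (le_csInf ⟨t, h⟩ fun s hs => capHit_le_of_mem hs) ?_
  refine le_csInf ⟨N, Or.inr rfl⟩ ?_
  rintro s (hs | hs)
  · exact hit_le hs
  · rw [mem_singleton_iff.1 hs]; exact (hit_le h).trans ht

lemma eventually_capHit_eq_hit (h : ∃ t, x.1 t ∈ C) :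
    ∀ᶠ N : ℕ in atTop, capHit C N x = hit C x := by
  obtain ⟨t, ht⟩ := h
  obtain ⟨n, hn⟩ := exists_nat_ge t
  filter_upwards [eventually_ge_atTop n] with N hN
  exact capHit_eq_hit ht (hn.trans (by exact_mod_cast hN))

lemma measurableSet_exists_mem_path {α : Type*} [MeasurableSpace α] {Y : α → ℝ≥0 → ℂ}
    (hY : ∀ a, Continuous (Y a)) (hC : IsClosed C) (hm : ∀ s, Measurable fun a => Y a s) :
    MeasurableSet {a | ∃ t, Y a t ∈ C} := by
  have : {a | ∃ t, Y a t ∈ C} = ⋃ n : ℕ, {a | ∃ s ≤ (n : ℝ≥0), Y a s ∈ C} := by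
    ext a
    simp only [mem_ofPred_eq, mem_iUnion]
    constructor
    · rintro ⟨t, ht⟩
      obtain ⟨n, hn⟩ := exists_nat_ge t
      exact ⟨n, t, hn, ht⟩
    · rintro ⟨n, t, -, ht⟩
      exact ⟨t, ht⟩
  rw [this]
  exact MeasurableSet.iUnion fun n => measurableSet_exists_le_mem hY hC fun s _ => hm s

lemma measurable_sInf_mem {α : Type*} [MeasurableSpace α] {Y : α → ℝ≥0 → ℂ}
    (hY : ∀ a, Continuous (Y a)) (hC : IsClosed C) (hm : ∀ s, Measurable fun a => Y a s) :
    Measurable fun a => sInf {t | Y a t ∈ C} := by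
  refine measurable_of_Iic fun t => ?_
  have : (fun a => sInf {t | Y a t ∈ C}) ⁻¹' Iic t =
      {a | ∃ s ≤ t, Y a s ∈ C} ∪ {a | ∃ t, Y a t ∈ C}ᶜ := by
    ext a
    simp only [mem_preimage, mem_Iic, mem_union, mem_compl_iff, mem_ofPred_eq]
    constructor
    · intro h
      by_cases h' : ∃ t, Y a t ∈ C
      · exact Or.inl ⟨_, h, (hC.preimage (hY a)).csInf_mem h' (OrderBot.bddBelow _)⟩
      · exact Or.inr h'
    · rintro (⟨s, hs, ha⟩ | h)
      · exact (csInf_le (OrderBot.bddBelow {t | Y a t ∈ C}) ha).trans hs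
      · have : {t | Y a t ∈ C} = ∅ := eq_empty_of_forall_notMem fun t ht => h ⟨t, ht⟩
        simp [this]
  rw [this]
  exact (measurableSet_exists_le_mem hY hC fun s _ => hm s).union (measurableSet_exists_mem_path hY hC hm).compl

lemma measurable_hit (hC : IsClosed C) : Measurable (hit C) :=
  measurable_sInf_mem (fun x : PathSpace => x.2.1) hC measurable_eval

end UncappedHitting

section Line

/-- The closed half-plane of points of imaginary part at most `-h`. -/
def below (h : ℝ) : Set ℂ := {z | z.im ≤ -h}

lemma isClosed_below (h : ℝ) : IsClosed (below h) := isClosed_le continuous_im continuous_const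

variable {ν : Measure PathSpace} {h : ℝ}

lemma neg_le_im_of_le_capHit (hh : 0 ≤ h) {N t : ℝ≥0} {x : PathSpace}
    (ht : t ≤ capHit (below h) N x) : -h ≤ (x.1 t).im := by
  by_contra! hlt
  have hpos : 0 < t := by
    rcases eq_or_ne t 0 with rfl | h0
    · rw [x.2.2] at hlt; simp at hlt; linarith
    · exact pos_iff_ne_zero.2 h0
  have ho : ∀ᶠ s in 𝓝[<] t, (x.1 s).im < -h :=
    (((continuous_im.comp x.2.1).tendsto t).eventually_lt_const hlt).filter_mono nhdsWithin_le_nhds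
  have : (𝓝[<] t).NeBot := nhdsLT_neBot_of_exists_lt ⟨0, hpos⟩
  obtain ⟨s, hs, hst⟩ := (ho.and self_mem_nhdsWithin).exists
  exact notMem_of_lt_capHit (lt_of_lt_of_le hst ht) (le_of_lt hs)

lemma im_hit_below (hh : 0 ≤ h) {x : PathSpace} (hx : ∃ t, x.1 t ∈ below h) :
    (x.1 (hit (below h) x)).im = -h := by
  refine le_antisymm (hit_mem (isClosed_below h) hx) ?_
  obtain ⟨t, ht⟩ := hx
  rw [← capHit_eq_hit ht le_rfl]
  exact neg_le_im_of_le_capHit hh le_rfl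

lemma norm_expMart (a b : ℂ) (t : ℝ≥0) (z : ℂ) : ‖expMart a b t z‖ =
    Real.exp (a.re * z.re + b.re * z.im - (a ^ 2 + b ^ 2).re * t / 2) := by
  rw [expMart, norm_exp]
  congr 1
  have : ((a ^ 2 + b ^ 2) * (t : ℝ) / 2 : ℂ) = (a ^ 2 + b ^ 2) * ((t / 2 : ℝ) : ℂ) := by
    push_cast; ring
  rw [this, sub_re, add_re, re_mul_ofReal, re_mul_ofReal, re_mul_ofReal]
  ring

theorem IsBM.ae_exists_mem_below (hν : IsBM ν) (hh : 0 ≤ h) :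
    ∀ᵐ x ∂ν, ∃ t, x.1 t ∈ below h := by
  have := hν.prob
  set H := {x : PathSpace | ∃ t, x.1 t ∈ below h}
  have hHm : MeasurableSet H := 
    measurableSet_exists_mem_path (fun x : PathSpace => x.2.1) (isClosed_below h) measurable_eval
  have key : ∀ κ : ℝ, ∀ N : ℕ,
      1 ≤ Real.exp (κ ^ 2 * h) * (ν.real H + Real.exp (-(κ ^ 2) ^ 2 * N / 2)) := by
    intro κ N
    have hT := isStop_capHit (isClosed_below h) N
    have h1 := hν.integral_expMart_stop hT (fun x => capHit_le) 0 (-(κ ^ 2 : ℝ))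
    have hi := (hν.integrable_expMart_stop hT (fun x => capHit_le) 0 (-(κ ^ 2 : ℝ))).norm
    have h2 := norm_integral_le_integral_norm (μ := ν)
      (fun x => expMart 0 (-(κ ^ 2 : ℝ)) (capHit (below h) N x) (x.1 (capHit (below h) N x)))
    rw [h1, norm_one] at h2
    refine h2.trans ?_
    have hle : ∀ x, ‖expMart 0 (-(κ ^ 2 : ℝ)) (capHit (below h) N x)
        (x.1 (capHit (below h) N x))‖ ≤
        Real.exp (κ ^ 2 * h) * (H.indicator 1 x + Real.exp (-(κ ^ 2) ^ 2 * N / 2)) := by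
      intro x
      have him := neg_le_im_of_le_capHit hh (le_refl (capHit (below h) N x))
      have hc : ((0 ^ 2 + (-((κ ^ 2 : ℝ) : ℂ)) ^ 2) : ℂ).re = (κ ^ 2) ^ 2 := by
        rw [show ((0 ^ 2 + (-((κ ^ 2 : ℝ) : ℂ)) ^ 2) : ℂ) = (((κ ^ 2) ^ 2 : ℝ) : ℂ) by
          push_cast; ring, ofReal_re]
      rw [norm_expMart, hc]
      simp only [zero_re, zero_mul, zero_add, neg_re, ofReal_re]
      by_cases hx : x ∈ H
      · rw [indicator_of_mem hx, Pi.one_apply, mul_add, mul_one]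
        refine le_add_of_le_of_nonneg (Real.exp_le_exp.2 ?_) (by positivity)
        have := mul_le_mul_of_nonneg_left him (sq_nonneg κ)
        have h3 : 0 ≤ (κ ^ 2) ^ 2 * (capHit (below h) N x : ℝ) / 2 := by positivity
        linarith
      · rw [indicator_of_notMem hx, zero_add, ← Real.exp_add]
        refine Real.exp_le_exp.2 ?_
        have hN : capHit (below h) N x = N :=
          ((capHit_mem (isClosed_below h)).resolve_left fun hm => hx ⟨_, hm⟩)
        have := mul_le_mul_of_nonneg_left him (sq_nonneg κ)
        rw [hN] at this ⊢
        push_cast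
        linarith
    have hind : Integrable (H.indicator (1 : PathSpace → ℝ)) ν :=
      (integrable_const 1).indicator hHm
    refine (integral_mono hi ((hind.add (integrable_const _)).const_mul _) hle).trans_eq ?_
    simp only [Pi.add_apply]
    rw [integral_const_mul, integral_add hind (integrable_const _), integral_indicator_one hHm,
      integral_const]
    simp
  have key2 : ∀ κ : ℝ, κ ≠ 0 → 1 ≤ Real.exp (κ ^ 2 * h) * ν.real H := by
    intro κ hκ
    have hlim : Tendsto (fun N : ℕ => Real.exp (-(κ ^ 2) ^ 2 * N / 2)) atTop (𝓝 0) := by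
      refine Real.tendsto_exp_atBot.comp ?_
      have : Tendsto (fun N : ℕ => -((κ ^ 2) ^ 2 / 2) * (N : ℝ)) atTop atBot :=
        tendsto_natCast_atTop_atTop.const_mul_atTop_of_neg (by
          have : 0 < (κ ^ 2) ^ 2 := by positivity
          linarith)
      exact this.congr fun N => by ring
    have h3 := (hlim.const_add (ν.real H)).const_mul (Real.exp (κ ^ 2 * h))
    rw [add_zero] at h3
    exact ge_of_tendsto' h3 (key κ)
  have key3 : 1 ≤ ν.real H := by
    have hlim : Tendsto (fun κ : ℝ => Real.exp (κ ^ 2 * h) * ν.real H) (𝓝[≠] 0)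
        (𝓝 (Real.exp ((0 : ℝ) ^ 2 * h) * ν.real H)) :=
      (Continuous.tendsto (by fun_prop) 0).mono_left nhdsWithin_le_nhds
    simp only [ne_eq, OfNat.ofNat_ne_zero, not_false_eq_true, zero_pow, zero_mul, Real.exp_zero,
      one_mul] at hlim
    exact ge_of_tendsto hlim (eventually_mem_nhdsWithin.mono fun κ hκ => key2 κ hκ)
  have h4 : ν H = 1 := by
    have : ν.real H = 1 := le_antisymm measureReal_le_one key3
    rwa [measureReal_def, ENNReal.toReal_eq_one_iff] at this
  exact (prob_compl_eq_zero_iff hHm).2 h4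

/-- The hitting distribution of a horizontal line is a Cauchy law. -/
theorem IsBM.map_hit_below (hν : IsBM ν) {h : ℝ≥0} (hh : h ≠ 0) :
    ν.map (fun x => (x.1 (hit (below h) x)).re) = cauchyMeasure 0 h := by
  have := hν.prob
  have hm : Measurable fun x : PathSpace => (x.1 (hit (below h) x)).re :=
    measurable_re.comp (measurable_eval_comp (measurable_hit (isClosed_below h)) measurable_id)
  have hfin : IsFiniteMeasure (cauchyMeasure 0 h) := by
    rw [cauchyMeasure_of_scale_ne_zero 0 hh]
    exact isFiniteMeasure_withDensity (by rw [lintegral_cauchyPDF_eq_one 0 hh]; simp)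
  have hprob := Measure.isProbabilityMeasure_map (μ := ν) hm.aemeasurable
  refine Measure.ext_of_charFun (funext fun ξ => ?_)
  rw [charFun_cauchyMeasure hh, charFun_apply_real,
    integral_map hm.aemeasurable (by fun_prop)]
  have hc : (ξ * I) ^ 2 + (-(|ξ| : ℝ) : ℂ) ^ 2 = 0 := by
    rw [neg_sq, ← ofReal_pow, sq_abs]
    push_cast
    linear_combination (ξ : ℂ) ^ 2 * I_sq
  have hlim := tendsto_integral_of_dominated_convergence (μ := ν)
    (F := fun (N : ℕ) x => expMart (ξ * I) (-(|ξ| : ℝ)) (capHit (below h) N x)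
      (x.1 (capHit (below h) N x)))
    (f := fun x => exp (ξ * (x.1 (hit (below h) x)).re * I) * exp ((h * |ξ| : ℝ)))
    (fun _ => Real.exp (|ξ| * h))
    (fun N => (hν.integrable_expMart_stop (isStop_capHit (isClosed_below h) N)
      (fun x => capHit_le) _ _).aestronglyMeasurable) (integrable_const _)
    (fun N => .of_forall fun x => by
      rw [norm_expMart, hc]
      have := mul_le_mul_of_nonneg_left
        (neg_le_im_of_le_capHit h.coe_nonneg (le_refl (capHit (below h) N x))) (abs_nonneg ξ)
      simp
      linarith)
    (by
      filter_upwards [hν.ae_exists_mem_below h.coe_nonneg] with x hx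
      refine tendsto_const_nhds.congr' ?_
      filter_upwards [eventually_capHit_eq_hit hx] with N hN
      rw [hN, expMart, hc, im_hit_below h.coe_nonneg hx, ← exp_add]
      congr 1
      push_cast
      ring)
  simp only [hν.integral_expMart_stop (isStop_capHit (isClosed_below h) _) (fun x => capHit_le),
    integral_mul_const] at hlim
  have h1 := tendsto_nhds_unique hlim tendsto_const_nhds
  rw [eq_div_of_mul_eq (exp_ne_zero _) h1, one_div, ← exp_neg, ofReal_neg]

end Line

section Maximal

variable {ν : Measure PathSpace}

lemma expMart_ofReal (a b : ℝ) (t : ℝ≥0) (z : ℂ) : expMart a b t z =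
    (Real.exp (a * z.re + b * z.im - (a ^ 2 + b ^ 2) * t / 2) : ℝ) := by
  rw [expMart]; push_cast; rfl

/-- Exponential maximal inequality for a coordinate. -/
lemma IsBM.measureReal_exists_le (hν : IsBM ν) {α β : ℝ} (hαβ : α ^ 2 + β ^ 2 = 1) {t : ℝ≥0}
    (ht : 0 < t) (r : ℝ) :
    ν.real {x | ∃ s ≤ t, r ≤ α * (x.1 s).re + β * (x.1 s).im} ≤ Real.exp (1 / 2 - r / √t) := by
  have := hν.prob
  have hst : 0 < √(t : ℝ) := Real.sqrt_pos.2 (by exact_mod_cast ht)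
  set κ := (√(t : ℝ))⁻¹ with hκ
  have hκ0 : 0 < κ := by positivity
  have hκt : κ ^ 2 * t = 1 := by
    rw [hκ, inv_pow, Real.sq_sqrt t.coe_nonneg]
    exact inv_mul_cancel₀ (by exact_mod_cast ht.ne')
  set C : Set ℂ := {z | r ≤ α * z.re + β * z.im}
  have hC : IsClosed C := isClosed_le continuous_const (by fun_prop)
  set T := capHit C t
  have h1 := hν.integral_expMart_stop (isStop_capHit hC t) (fun x => capHit_le)
    (κ * α : ℝ) (κ * β : ℝ)
  have hi := hν.integrable_expMart_stop (isStop_capHit hC t) (fun x => capHit_le)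
    (κ * α : ℝ) (κ * β : ℝ)
  simp only [expMart_ofReal] at h1 hi
  have h1' := ofReal_eq_one.1 (integral_complex_ofReal.symm.trans h1)
  have hi' := hi.re
  simp only [RCLike.re_to_complex, ofReal_re] at hi'
  have h2 := mul_meas_ge_le_integral_of_nonneg (.of_forall fun x => (Real.exp_pos _).le) hi'
    (Real.exp (κ * r - 1 / 2))
  rw [h1'] at h2
  have h3 : ν.real {x | ∃ s ≤ t, r ≤ α * (x.1 s).re + β * (x.1 s).im} ≤
      ν.real {x | Real.exp (κ * r - 1 / 2) ≤ Real.exp ((κ * α) * (x.1 (T x)).re +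
        (κ * β) * (x.1 (T x)).im - ((κ * α) ^ 2 + (κ * β) ^ 2) * (T x) / 2)} := by
    refine measureReal_mono ?_
    rintro x ⟨s, hs, hx⟩
    refine Real.exp_le_exp.2 ?_
    have hm : x.1 (T x) ∈ C := by
      rw [show T x = hit C x from capHit_eq_hit (x := x) (C := C) hx hs]
      exact hit_mem hC ⟨s, hx⟩
    have hT : (T x : ℝ) ≤ t := capHit_le
    have e1 : (κ * α) ^ 2 + (κ * β) ^ 2 = κ ^ 2 := by linear_combination κ ^ 2 * hαβ
    have e2 : κ ^ 2 * T x ≤ 1 := hκt ▸ mul_le_mul_of_nonneg_left hT (sq_nonneg κ)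
    have e3 := mul_le_mul_of_nonneg_left (show r ≤ α * (x.1 (T x)).re + β * (x.1 (T x)).im from hm)
      hκ0.le
    rw [e1]
    linarith
  refine h3.trans ?_
  have h4 : 1 / 2 - r / √t = -(κ * r - 1 / 2) := by
    rw [div_eq_mul_inv r, ← hκ]; ring
  rw [h4, Real.exp_neg, ← one_div, le_div_iff₀ (Real.exp_pos _), mul_comm]
  exact h2

lemma IsBM.measureReal_exists_norm (hν : IsBM ν) {t : ℝ≥0} (ht : 0 < t) (r : ℝ) :
    ν.real {x | ∃ s ≤ t, r ≤ ‖x.1 s‖} ≤ 4 * Real.exp (1 / 2 - r / 2 / √t) := by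
  have := hν.prob
  have h : ∀ α β : ℝ, α ^ 2 + β ^ 2 = 1 → _ := fun α β h =>
    hν.measureReal_exists_le h ht (r / 2)
  have hsub : {x : PathSpace | ∃ s ≤ t, r ≤ ‖x.1 s‖} ⊆
      (({x | ∃ s ≤ t, r / 2 ≤ 1 * (x.1 s).re + 0 * (x.1 s).im} ∪
      {x | ∃ s ≤ t, r / 2 ≤ (-1) * (x.1 s).re + 0 * (x.1 s).im}) ∪
      {x | ∃ s ≤ t, r / 2 ≤ 0 * (x.1 s).re + 1 * (x.1 s).im}) ∪
      {x | ∃ s ≤ t, r / 2 ≤ 0 * (x.1 s).re + (-1) * (x.1 s).im} := by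
    rintro x ⟨s, hs, hx⟩
    simp only [mem_union, mem_ofPred_eq]
    have h1 := hx.trans (Complex.norm_le_abs_re_add_abs_im (x.1 s))
    by_contra! hcon
    obtain ⟨⟨⟨c1, c2⟩, c3⟩, c4⟩ := hcon
    have c1 := c1 s hs
    have c2 := c2 s hs
    have c3 := c3 s hs
    have c4 := c4 s hs
    rcases abs_cases (x.1 s).re with ⟨e1, -⟩ | ⟨e1, -⟩ <;>
    rcases abs_cases (x.1 s).im with ⟨e2, -⟩ | ⟨e2, -⟩ <;> linarith
  have u := measureReal_mono (μ := ν) hsub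
  refine u.trans ((measureReal_union_le _ _).trans ?_)
  have u1 := h 1 0 (by norm_num)
  have u2 := h (-1) 0 (by norm_num)
  have u3 := h 0 1 (by norm_num)
  have u4 := h 0 (-1) (by norm_num)
  refine (add_le_add (measureReal_union_le _ _) le_rfl).trans ?_
  refine (add_le_add (add_le_add (measureReal_union_le _ _) le_rfl) le_rfl).trans ?_
  linarith

end Maximal

section Support

variable {ν : Measure PathSpace}

lemma measurableSet_forall_mem {K : Set (ℝ≥0 × ℂ)} (hK : IsClosed K) (t : ℝ≥0) :
    MeasurableSet[pastFiltration t] {x : PathSpace | ∀ s ≤ t, (s, x.1 s) ∈ K} := by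
  have : Nonempty (Iic t) := ⟨⟨t, mem_Iic.2 le_rfl⟩⟩
  have h : {x : PathSpace | ∀ s ≤ t, (s, x.1 s) ∈ K} = ⋂ k : ℕ,
      {x | ((TopologicalSpace.denseSeq (Iic t) k : ℝ≥0),
        x.1 (TopologicalSpace.denseSeq (Iic t) k)) ∈ K} := by
    ext x
    simp only [mem_ofPred_eq, mem_iInter]
    refine ⟨fun h k => h _ (TopologicalSpace.denseSeq (Iic t) k).2, fun h s hs => ?_⟩
    have hc : IsClosed {u : Iic t | ((u : ℝ≥0), x.1 u) ∈ K} := hK.preimage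
      (continuous_subtype_val.prodMk (x.2.1.comp continuous_subtype_val))
    have := hc.closure_subset_iff.2 (range_subset_iff.2 h)
      ((TopologicalSpace.denseRange_denseSeq (Iic t)) ⟨s, hs⟩)
    exact this
  rw [h]
  refine MeasurableSet.iInter fun k => ?_
  exact (measurable_const.prodMk (measurable_past_eval (TopologicalSpace.denseSeq (Iic t) k).2))
    hK.measurableSet

lemma gaussianReal_Icc_ge {δ : ℝ≥0} (hδ : 0 < δ) {a r M : ℝ} (hr : 0 ≤ r) (ha : |a| + r ≤ M) :
    2 * r * ((√(2 * Real.pi * δ))⁻¹ * Real.exp (-M ^ 2 / (2 * δ))) ≤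
      (gaussianReal 0 δ).real (Icc (a - r) (a + r)) := by
  rw [measureReal_def, gaussianReal_apply_eq_integral 0 hδ.ne', ENNReal.toReal_ofReal
    (setIntegral_nonneg measurableSet_Icc fun x _ => gaussianPDFReal_nonneg _ _ _)]
  have h : ∫ x in Icc (a - r) (a + r), ((√(2 * Real.pi * δ))⁻¹ * Real.exp (-M ^ 2 / (2 * δ))) ≤
      ∫ x in Icc (a - r) (a + r), gaussianPDFReal 0 δ x := by
    refine setIntegral_mono_on (integrable_const _) (integrable_gaussianPDFReal 0 δ).integrableOn
      measurableSet_Icc fun x hx => ?_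
    have hsq : (x - 0) ^ 2 ≤ M ^ 2 := by
      rw [sub_zero, sq_le_sq]
      refine le_trans ?_ (ha.trans (le_abs_self M))
      rw [abs_le]
      have h1 := neg_abs_le a
      have h2 := le_abs_self a
      constructor <;> linarith [hx.1, hx.2]
    rw [gaussianPDFReal]
    refine mul_le_mul_of_nonneg_left (Real.exp_le_exp.2 ?_) (by positivity)
    exact div_le_div_of_nonneg_right (neg_le_neg hsq) (by positivity)
  refine le_trans (le_of_eq ?_) h
  rw [setIntegral_const, measureReal_def, Real.volume_Icc, ENNReal.toReal_ofReal (by linarith),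
    smul_eq_mul]
  ring

lemma gaussC_ball_ge {δ : ℝ≥0} (hδ : 0 < δ) {v : ℂ} {r M : ℝ} (hr : 0 ≤ r) (hv : ‖v‖ + r ≤ M) :
    (2 * r * ((√(2 * Real.pi * δ))⁻¹ * Real.exp (-M ^ 2 / (2 * δ)))) ^ 2 ≤
      (gaussC δ).real (Metric.closedBall v (2 * r)) := by
  have hsub : Icc (v.re - r) (v.re + r) ×ˢ Icc (v.im - r) (v.im + r) ⊆
      (fun p : ℝ × ℝ => (equivRealProd.symm p : ℂ)) ⁻¹' Metric.closedBall v (2 * r) := by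
    rintro ⟨p, q⟩ ⟨hp, hq⟩
    simp only [mem_preimage, Metric.mem_closedBall, dist_eq_norm]
    refine (norm_le_abs_re_add_abs_im _).trans ?_
    have h1 : |p - v.re| ≤ r := abs_le.2 ⟨by linarith [hp.1], by linarith [hp.2]⟩
    have h2 : |q - v.im| ≤ r := abs_le.2 ⟨by linarith [hq.1], by linarith [hq.2]⟩
    simp [equivRealProd_symm_apply]
    linarith
  rw [gaussC, map_measureReal_apply measurable_equivRealProd_symm
    Metric.isClosed_closedBall.measurableSet, pow_two]
  refine le_trans ?_ (measureReal_mono hsub)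
  rw [measureReal_prod_prod]
  exact mul_le_mul
    (gaussianReal_Icc_ge hδ hr (by linarith [abs_re_le_norm v]))
    (gaussianReal_Icc_ge hδ hr (by linarith [abs_im_le_norm v])) (by positivity) (by positivity)

end Support

section LoopEvent

variable {ν : Measure PathSpace}

/-- Paths that move by about `v` in time `δ` without large excursions. -/
def stepEvent (δ : ℝ≥0) (v : ℂ) : Set PathSpace :=
  {x | x.1 δ ∈ Metric.closedBall v (δ / 192)} ∩ {x | ∀ s ≤ δ, ‖x.1 s‖ ≤ 1 / 16}

lemma measurableSet_stepEvent (δ : ℝ≥0) (v : ℂ) :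
    MeasurableSet[pastFiltration δ] (stepEvent δ v) := by
  refine MeasurableSet.inter (measurable_past_eval le_rfl Metric.isClosed_closedBall.measurableSet)
    (measurableSet_forall_mem (K := {p | ‖p.2‖ ≤ 1 / 16}) ?_ δ)
  exact isClosed_le (by fun_prop) continuous_const

lemma IsBM.stepEvent_pos (hν : IsBM ν) : ∃ m : ℕ, 864 ≤ m ∧ ∀ v : ℂ,
    ‖v‖ ≤ 27 * ((m : ℝ) ^ 2)⁻¹ → 0 < ν (stepEvent (((m : ℝ≥0) ^ 2)⁻¹) v) := by
  have := hν.prob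
  have hlim : Tendsto (fun m : ℕ => ((m : ℝ) / 32) ^ 2 * Real.exp (-((m : ℝ) / 32)))
      atTop (𝓝 0) :=
    (Real.tendsto_pow_mul_exp_neg_atTop_nhds_zero 2).comp
      (tendsto_natCast_atTop_atTop.atTop_div_const (by norm_num))
  set κ := (4 / (384 ^ 2 * (2 * Real.pi)) * Real.exp (-784)) / (4096 * Real.exp (1 / 2)) with hκ
  have hκ0 : 0 < κ := by positivity
  obtain ⟨m, hm1, hm2⟩ := ((hlim.eventually_lt_const hκ0).and (eventually_ge_atTop 864)).exists
  refine ⟨m, hm2, fun v hv => ?_⟩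
  have hm0 : (0 : ℝ) < m := by exact_mod_cast (by omega : 0 < m)
  have hmR : (864 : ℝ) ≤ m := by exact_mod_cast hm2
  set δ : ℝ≥0 := ((m : ℝ≥0) ^ 2)⁻¹ with hδ
  have hδR : (δ : ℝ) = ((m : ℝ) ^ 2)⁻¹ := by simp [hδ]
  have hδ0 : 0 < δ := by
    rw [← NNReal.coe_pos, hδR]; positivity
  have hδ1 : (δ : ℝ) ≤ 1 := by
    rw [hδR]
    exact inv_le_one_of_one_le₀ (one_le_pow₀ (by linarith))
  have hsq : √(δ : ℝ) = (m : ℝ)⁻¹ := by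
    rw [hδR, ← inv_pow, Real.sqrt_sq (by positivity)]
  have h1 := gaussC_ball_ge hδ0 (v := v) (r := δ / 384) (M := 28 * δ) (by positivity) (by
    rw [hδR] at *; nlinarith)
  have h2 := hν.measureReal_exists_norm hδ0 (1 / 16)
  have h3 : ν.real {x | x.1 δ ∈ Metric.closedBall v (δ / 192)} =
      (gaussC δ).real (Metric.closedBall v (2 * (δ / 384))) := by
    rw [← hν.map_eval, map_measureReal_apply (measurable_eval δ)
      Metric.isClosed_closedBall.measurableSet]
    congr 2
    ext x
    rw [show (2 : ℝ) * (δ / 384) = δ / 192 by ring]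
  have h4 : ν.real {x | x.1 δ ∈ Metric.closedBall v (δ / 192)} ≤
      ν.real (stepEvent δ v) + ν.real {x | ∃ s ≤ δ, 1 / 16 ≤ ‖x.1 s‖} := by
    refine (measureReal_mono ?_).trans (measureReal_union_le _ _)
    intro x hx
    by_cases h : ∃ s ≤ δ, 1 / 16 ≤ ‖x.1 s‖
    · exact Or.inr h
    · push Not at h
      exact Or.inl ⟨hx, fun s hs => (h s hs).le⟩
  have h5 : (2 * (δ / 384 : ℝ) * ((√(2 * Real.pi * δ))⁻¹ *
      Real.exp (-(28 * δ : ℝ) ^ 2 / (2 * δ)))) ^ 2 =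
      4 / (384 ^ 2 * (2 * Real.pi)) * δ * Real.exp (-784 * δ) := by
    have hd : (δ : ℝ) ≠ 0 := by exact_mod_cast hδ0.ne'
    rw [show -(28 * δ : ℝ) ^ 2 / (2 * δ) = -392 * δ by field_simp; norm_num, mul_pow, mul_pow,
      mul_pow, inv_pow, Real.sq_sqrt (by positivity), ← Real.exp_nat_mul]
    rw [show ((2 : ℕ) : ℝ) * (-392 * δ) = -784 * δ by push_cast; ring]
    field_simp
    norm_num
  have h6 : Real.exp (-784) ≤ Real.exp (-784 * δ) := Real.exp_le_exp.2 (by linarith)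
  have h7 : 4 * Real.exp (1 / 2 - 1 / 16 / 2 / √δ) <
      4 / (384 ^ 2 * (2 * Real.pi)) * δ * Real.exp (-784) := by
    rw [hsq, show (1 / 2 - 1 / 16 / 2 / (m : ℝ)⁻¹ : ℝ) = 1 / 2 + -(m / 32) by
        field_simp; ring,
      Real.exp_add]
    rw [hκ, lt_div_iff₀ (by positivity)] at hm1
    rw [hδR]
    have : 4 * (Real.exp (1 / 2) * Real.exp (-((m : ℝ) / 32))) =
        (((m : ℝ) / 32) ^ 2 * Real.exp (-(m / 32)) * (4096 * Real.exp (1 / 2))) *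
        ((m : ℝ) ^ 2)⁻¹ := by
      field_simp
      norm_num
    rw [this]
    calc _ < 4 / (384 ^ 2 * (2 * Real.pi)) * Real.exp (-784) * ((m : ℝ) ^ 2)⁻¹ :=
          mul_lt_mul_of_pos_right hm1 (by positivity)
      _ = _ := by ring
  have h8 : 4 / (384 ^ 2 * (2 * Real.pi)) * δ * Real.exp (-784) ≤
      4 / (384 ^ 2 * (2 * Real.pi)) * δ * Real.exp (-784 * δ) :=
    mul_le_mul_of_nonneg_left h6 (by positivity)
  rw [h5] at h1
  rw [h3] at h4
  have : 0 < ν.real (stepEvent δ v) := by linarith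
  exact (ENNReal.toReal_pos_iff.1 this).1

/-- Paths staying close to the reference loop up to time `6`. -/
def nearLoop : Set PathSpace := {x | ∀ s ≤ (6 : ℝ≥0), ‖x.1 s - loopPath s‖ ≤ 1 / 8}

lemma measurableSet_nearLoop : MeasurableSet[pastFiltration 6] nearLoop := by
  refine measurableSet_forall_mem (K := {p | ‖p.2 - loopPath p.1‖ ≤ 1 / 8}) ?_ 6
  have : Continuous loopPath := (LipschitzWith.of_dist_le_mul (K := 27) fun s t => by
    rw [dist_eq_norm, Real.dist_eq]; exact loopPath_lipschitz s t).continuous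
  exact isClosed_le (by fun_prop) continuous_const

theorem IsBM.nearLoop_pos (hν : IsBM ν) : 0 < ν nearLoop := by
  have := hν.prob
  obtain ⟨m, hm, hpos⟩ := hν.stepEvent_pos
  have hm0 : (0 : ℝ) < m := by exact_mod_cast (by omega : 0 < m)
  have hmR : (864 : ℝ) ≤ m := by exact_mod_cast hm
  set δ : ℝ≥0 := ((m : ℝ≥0) ^ 2)⁻¹ with hδ
  have hδR : (δ : ℝ) = ((m : ℝ) ^ 2)⁻¹ := by simp [hδ]
  have hδ0 : 0 < (δ : ℝ) := by rw [hδR]; positivity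
  have hδ864 : (δ : ℝ) ≤ 1 / 864 := by
    rw [hδR, one_div]
    exact inv_anti₀ (by norm_num) (by nlinarith)
  let v : ℕ → ℂ := fun i => loopPath ((i + 1) * δ) - loopPath (i * δ)
  have hv : ∀ i, ‖v i‖ ≤ 27 * ((m : ℝ) ^ 2)⁻¹ := fun i => by
    refine (loopPath_lipschitz _ _).trans ?_
    rw [show ((i : ℝ) + 1) * δ - i * δ = δ by ring, abs_of_pos hδ0, hδR]
  have hE : ∀ k : ℕ, MeasurableSet[pastFiltration (k * δ)]
      {x : PathSpace | ∀ i < k, shift (i * δ) x ∈ stepEvent δ (v i)} ∧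
      0 < ν {x : PathSpace | ∀ i < k, shift (i * δ) x ∈ stepEvent δ (v i)} := by
    intro k
    induction k with
    | zero => simp
    | succ k ih =>
      have hs : {x : PathSpace | ∀ i < k + 1, shift (i * δ) x ∈ stepEvent δ (v i)} =
          {x : PathSpace | ∀ i < k, shift (i * δ) x ∈ stepEvent δ (v i)} ∩
          shift (k * δ) ⁻¹' stepEvent δ (v k) := by
        ext x
        simp only [mem_ofPred_eq, mem_inter_iff, mem_preimage, Nat.lt_succ_iff_lt_or_eq]
        exact ⟨fun h => ⟨fun i hi => h i (Or.inl hi), h k (Or.inr rfl)⟩,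
          fun h i hi => hi.elim (h.1 i) fun e => e ▸ h.2⟩
      rw [hs, show ((k + 1 : ℕ) : ℝ≥0) * δ = k * δ + δ by push_cast; ring]
      refine ⟨(pastFiltration.mono le_self_add _ ih.1).inter
        (measurableSet_shift_preimage _ _ (measurableSet_stepEvent δ _)), ?_⟩
      rw [hν.markov ih.1 (measurableSet_of_past (measurableSet_stepEvent δ _))]
      exact ENNReal.mul_pos ih.2.ne' (hpos _ (hv k)).ne'
  refine (hE (6 * m ^ 2 + 1)).2.trans_le (measure_mono fun x hx => ?_)
  rw [mem_ofPred_eq] at hx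
  have hgrid : ∀ k ≤ 6 * m ^ 2 + 1, ‖x.1 (k * δ) - loopPath (k * δ)‖ ≤ k * (δ / 192) := by
    intro k hk
    induction k with
    | zero => simp [x.2.2, loopPath_zero]
    | succ k ih =>
      have h1 := ih (by omega)
      have h2 : ‖(x.1 (k * δ + δ) - x.1 (k * δ)) - v k‖ ≤ δ / 192 := by
        rw [← dist_eq_norm]; exact (hx k (by omega)).1
      rw [show ((k + 1 : ℕ) : ℝ≥0) * δ = k * δ + δ by push_cast; ring]
      have e : x.1 (k * δ + δ) - loopPath (((k + 1 : ℕ) : ℝ) * δ) =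
          (x.1 (k * δ) - loopPath (k * δ)) + ((x.1 (k * δ + δ) - x.1 (k * δ)) - v k) := by
        simp only [v]; push_cast; ring
      rw [e]
      refine (norm_add_le _ _).trans ((add_le_add h1 h2).trans_eq ?_)
      push_cast; ring
  intro s hs
  obtain ⟨k, hk1, hk2⟩ : ∃ k : ℕ, k * (δ : ℝ) ≤ s ∧ (s : ℝ) ≤ k * δ + δ := by
    refine ⟨⌊(s : ℝ) / δ⌋₊, ?_, ?_⟩
    · exact (le_div_iff₀ hδ0).1 (Nat.floor_le (by positivity))
    · have := (Nat.lt_floor_add_one ((s : ℝ) / δ)).le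
      rw [div_le_iff₀ hδ0] at this
      linarith
  have hs6 : (s : ℝ) ≤ 6 := by exact_mod_cast hs
  have hkδ : k * (δ : ℝ) ≤ 6 := hk1.trans hs6
  have hk : k ≤ 6 * m ^ 2 := by
    have : (k : ℝ) ≤ 6 * m ^ 2 := by
      rwa [hδR, ← div_eq_mul_inv, div_le_iff₀ (by positivity)] at hkδ
    exact_mod_cast this
  have h1 := hgrid k (by omega)
  have hks : (k : ℝ≥0) * δ ≤ s := by rw [← NNReal.coe_le_coe]; push_cast; exact hk1
  have h2 : ‖x.1 s - x.1 (k * δ)‖ ≤ 1 / 16 := by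
    have := (hx k (by omega)).2 (s - k * δ) (by
      rw [tsub_le_iff_left, ← NNReal.coe_le_coe]; push_cast; exact hk2)
    rw [shift] at this
    simpa only [add_tsub_cancel_of_le hks] using this
  have h3 : ‖loopPath (k * δ) - loopPath s‖ ≤ 27 * δ := by
    refine (loopPath_lipschitz _ _).trans ?_
    gcongr
    rw [abs_le]; constructor <;> linarith
  have e : x.1 s - loopPath s = (x.1 s - x.1 (k * δ)) + (x.1 (k * δ) - loopPath (k * δ)) +
      (loopPath (k * δ) - loopPath s) := by ring
  rw [e]
  refine (norm_add₃_le).trans ?_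
  have : (k : ℝ) * (δ / 192) ≤ 6 / 192 := by rw [← mul_div_assoc]; gcongr
  have h4 : 27 * (δ : ℝ) ≤ 1 / 32 := by linarith
  linarith

end LoopEvent

section SmallLoops

variable {ν : Measure PathSpace}

/-- At arbitrarily small times the path makes a scaled copy of the reference loop. -/
def HasSmallLoops (x : PathSpace) : Prop :=
  ∀ ε : ℝ, 0 < ε → ∃ a b : ℝ≥0, 0 < b ∧ (a + 6 * b : ℝ) ≤ ε ∧ ‖x.1 a‖ ≤ √b / 16 ∧
    ∀ s ≤ (6 : ℝ≥0), ‖x.1 (a + b * s) - x.1 a - √b * loopPath s‖ ≤ √b / 8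

lemma measurableSet_scale_preimage (c u : ℝ≥0) {A : Set PathSpace}
    (hA : MeasurableSet[pastFiltration u] A) :
    MeasurableSet[pastFiltration (c * u)] (scale c ⁻¹' A) := by
  obtain ⟨A', hA', rfl⟩ := hA
  rw [← preimage_comp]
  refine @measurable_pi_lambda _ _ _ (pastFiltration (c * u)) _ _ (fun v => ?_) _ hA'
  exact (measurable_past_eval (mul_le_mul_of_nonneg_left (mem_Iic.1 v.2) c.coe_nonneg)).const_smul
    (√(c : ℝ))⁻¹

/-- Durations of the loops. -/
noncomputable def loopScale (k : ℕ) : ℝ≥0 := (1 / 2) ^ ((k + 1) ^ 2 + 3)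

/-- Starting times of the loops. -/
noncomputable def loopStart (k : ℕ) : ℝ≥0 := loopScale k / 4 ^ k

lemma loopScale_pos (k : ℕ) : 0 < loopScale k := by rw [loopScale]; positivity

lemma loopStart_pos (k : ℕ) : 0 < loopStart k := div_pos (loopScale_pos k) (by positivity)

lemma loopStart_le (k : ℕ) : loopStart k ≤ loopScale k :=
  div_le_self (zero_le) (one_le_pow₀ (by norm_num))

lemma loop_disjoint (k : ℕ) : loopStart (k + 1) + loopScale (k + 1) * 6 ≤ loopStart k := by
  have h : loopScale (k + 1) * 7 ≤ loopStart k := by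
    have e : loopScale (k + 1) = loopScale k * ((1 / 4) ^ k * (1 / 8)) := by
      rw [loopScale, loopScale, show (1 / 4 : ℝ≥0) = (1 / 2) ^ 2 by norm_num, ← pow_mul,
        show (1 / 8 : ℝ≥0) = (1 / 2) ^ 3 by norm_num, ← pow_add, ← pow_add]
      congr 1; ring
    rw [e, loopStart, div_eq_mul_inv (loopScale k), mul_assoc]
    refine mul_le_mul_of_nonneg_left ?_ (loopScale_pos k).le
    rw [← inv_pow, ← one_div, mul_assoc]
    exact mul_le_of_le_one_right (zero_le) (by norm_num [← NNReal.coe_le_coe])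
  have h2 := loopStart_le (k + 1)
  calc _ ≤ loopScale (k + 1) + loopScale (k + 1) * 6 := by gcongr
    _ = loopScale (k + 1) * 7 := by ring
    _ ≤ _ := h

/-- The `k`-th loop is performed. -/
def loopEvent (k : ℕ) : Set PathSpace := shift (loopStart k) ⁻¹' (scale (loopScale k) ⁻¹' nearLoop)

lemma measurableSet_loopEvent (k : ℕ) :
    MeasurableSet[pastFiltration (loopStart k + loopScale k * 6)] (loopEvent k) :=
  measurableSet_shift_preimage _ _ (measurableSet_scale_preimage _ _ measurableSet_nearLoop)

lemma IsBM.measure_forall_notMem_loopEvent (hν : IsBM ν) (r : ℕ) : ∀ m : ℕ,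
    MeasurableSet[pastFiltration (loopStart m + loopScale m * 6)]
      {x | ∀ k, m ≤ k → k < m + r → x ∉ loopEvent k} ∧
    ν {x | ∀ k, m ≤ k → k < m + r → x ∉ loopEvent k} = ν nearLoopᶜ ^ r := by
  have := hν.prob
  induction r with
  | zero =>
    intro m
    have h : {x : PathSpace | ∀ k, m ≤ k → k < m + 0 → x ∉ loopEvent k} = univ :=
      eq_univ_of_forall fun x k h1 h2 => by omega
    rw [h]; simp
  | succ r ih =>
    intro m
    have h : {x : PathSpace | ∀ k, m ≤ k → k < m + (r + 1) → x ∉ loopEvent k} =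
        {x | ∀ k, m + 1 ≤ k → k < m + 1 + r → x ∉ loopEvent k} ∩ (loopEvent m)ᶜ := by
      ext x
      simp only [mem_ofPred_eq, mem_inter_iff, mem_compl_iff]
      refine ⟨fun h => ⟨fun k h1 h2 => h k (by omega) (by omega), h m le_rfl (by omega)⟩,
        fun h k h1 h2 => ?_⟩
      rcases h1.eq_or_lt with rfl | h3
      · exact h.2
      · exact h.1 k h3 (by omega)
    have h1 := pastFiltration.mono (loop_disjoint m) _ (ih (m + 1)).1
    rw [h]
    refine ⟨(pastFiltration.mono le_self_add _ h1).inter (measurableSet_loopEvent m).compl, ?_⟩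
    have hN : MeasurableSet nearLoop := measurableSet_of_past measurableSet_nearLoop
    rw [loopEvent, ← preimage_compl, ← preimage_compl,
      hν.markov h1 (measurable_scale _ hN.compl), (ih (m + 1)).2,
      ← Measure.map_apply (measurable_scale _) hN.compl, hν.map_scale (loopScale_pos m).ne',
      pow_succ]

lemma IsBM.ae_frequently_loopEvent (hν : IsBM ν) :
    ∀ᵐ x ∂ν, ∃ᶠ k in atTop, x ∈ loopEvent k := by
  have := hν.prob
  have hq : ν nearLoopᶜ < 1 := by
    rw [prob_compl_eq_one_sub (measurableSet_of_past measurableSet_nearLoop)]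
    exact ENNReal.sub_lt_self ENNReal.one_ne_top one_ne_zero hν.nearLoop_pos.ne'
  have h : ∀ m : ℕ, ∀ᵐ x ∂ν, ∃ k, m ≤ k ∧ x ∈ loopEvent k := by
    intro m
    rw [ae_iff]
    refine le_antisymm (ge_of_tendsto' (ENNReal.tendsto_pow_atTop_nhds_zero_of_lt_one hq)
      fun r => ?_) (zero_le)
    rw [← (hν.measure_forall_notMem_loopEvent r m).2]
    refine measure_mono fun x hx k h1 _ hk => hx ⟨k, h1, hk⟩
  filter_upwards [ae_all_iff.2 h] with x hx
  exact frequently_atTop.2 hx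

lemma IsBM.ae_eventually_norm_le (hν : IsBM ν) :
    ∀ᵐ x ∂ν, ∀ᶠ k in atTop, ‖x.1 (loopStart k)‖ ≤ √(loopScale k) / 16 := by
  have := hν.prob
  have hb : ∀ k, ν {x | ¬ ‖x.1 (loopStart k)‖ ≤ √(loopScale k) / 16} ≤
      ENNReal.ofReal ((128 * Real.exp (1 / 2)) * (1 / 2) ^ k) := by
    intro k
    rw [ENNReal.le_ofReal_iff_toReal_le (measure_ne_top _ _) (by positivity)]
    have h1 := hν.measureReal_exists_norm (loopStart_pos k) (√(loopScale k) / 16)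
    have h2 : ν.real {x | ¬ ‖x.1 (loopStart k)‖ ≤ √(loopScale k) / 16} ≤
        ν.real {x | ∃ s ≤ loopStart k, √(loopScale k) / 16 ≤ ‖x.1 s‖} :=
      measureReal_mono fun x hx => ⟨loopStart k, le_rfl, (not_le.1 hx).le⟩
    refine (h2.trans h1).trans ?_
    have hs : √(loopStart k : ℝ) = √(loopScale k) / 2 ^ k := by
      rw [loopStart, NNReal.coe_div, NNReal.coe_pow, Real.sqrt_div (by positivity),
        show ((4 : ℝ≥0) : ℝ) ^ k = (2 ^ k) ^ 2 by rw [← pow_mul, mul_comm, pow_mul]; norm_num,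
        Real.sqrt_sq (by positivity)]
    have hb0 : 0 < √(loopScale k : ℝ) := Real.sqrt_pos.2 (by exact_mod_cast loopScale_pos k)
    rw [show 1 / 2 - √(loopScale k : ℝ) / 16 / 2 / √(loopStart k : ℝ) = 1 / 2 + -(2 ^ k / 32) by
      rw [hs]; field_simp; ring, Real.exp_add, Real.exp_neg]
    have h3 : (2 : ℝ) ^ k / 32 ≤ Real.exp (2 ^ k / 32) := by
      linarith [Real.add_one_le_exp ((2 : ℝ) ^ k / 32)]
    have h4 : (Real.exp ((2 : ℝ) ^ k / 32))⁻¹ ≤ ((2 : ℝ) ^ k / 32)⁻¹ :=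
      inv_anti₀ (by positivity) h3
    calc _ ≤ 4 * (Real.exp (1 / 2) * ((2 : ℝ) ^ k / 32)⁻¹) := by gcongr
      _ = _ := by rw [inv_div, one_div_pow]; ring
  have hsum : ∑' k, ν {x | ¬ ‖x.1 (loopStart k)‖ ≤ √(loopScale k) / 16} ≠ ∞ := by
    refine ne_top_of_le_ne_top ?_ (ENNReal.tsum_le_tsum hb)
    exact (Summable.mul_left _ (summable_geometric_of_lt_one (by norm_num)
      (by norm_num))).tsum_ofReal_ne_top
  filter_upwards [ae_eventually_notMem hsum] with x hx
  filter_upwards [hx] with k hk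
  exact not_not.1 hk

theorem IsBM.ae_hasSmallLoops (hν : IsBM ν) : ∀ᵐ x ∂ν, HasSmallLoops x := by
  filter_upwards [hν.ae_frequently_loopEvent, hν.ae_eventually_norm_le] with x h1 h2 ε hε
  have hlim : Tendsto (fun k : ℕ => 7 * (1 / 2 : ℝ) ^ k) atTop (𝓝 0) := by
    simpa using (tendsto_pow_atTop_nhds_zero_of_lt_one (r := (1 / 2 : ℝ)) (by norm_num)
      (by norm_num)).const_mul 7
  obtain ⟨k, hk1, hk2, hk3⟩ := (h1.and_eventually (h2.and (hlim.eventually_le_const hε))).exists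
  have hb0 : 0 < √(loopScale k : ℝ) := Real.sqrt_pos.2 (by exact_mod_cast loopScale_pos k)
  refine ⟨loopStart k, loopScale k, loopScale_pos k, le_trans ?_ hk3, hk2, fun s hs => ?_⟩
  · have e1 : (loopStart k : ℝ) ≤ loopScale k := loopStart_le k
    have e2 : (loopScale k : ℝ) ≤ (1 / 2) ^ k := by
      rw [loopScale]; push_cast
      exact pow_le_pow_of_le_one (by norm_num) (by norm_num) (by nlinarith)
    linarith
  · have h := hk1 s hs
    have e : x.1 (loopStart k + loopScale k * s) - x.1 (loopStart k) -
        √(loopScale k) * loopPath s = √(loopScale k) *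
        ((scale (loopScale k) (shift (loopStart k) x)).1 s - loopPath s) := by
      have : ((√(loopScale k : ℝ) : ℝ) : ℂ) ≠ 0 := ofReal_ne_zero.2 hb0.ne'
      simp only [scale, shift, real_smul, ofReal_inv]
      field_simp
    rw [e, norm_mul, norm_real, Real.norm_of_nonneg hb0.le]
    calc _ ≤ √(loopScale k : ℝ) * (1 / 8) := by gcongr
      _ = _ := by ring

end SmallLoops

section Exit

/-- Displacements leading from `w` out of `UH \ F`. -/
def exitSet (F : Set ℂ) (w : ℂ) : Set ℂ := {z | w + z ∉ UH \ F}

/-- Imaginary part of the exit point from `UH \ F` of the path `x` started at `w`. -/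
noncomputable def exitIm (F : Set ℂ) (w : ℂ) (x : PathSpace) : ℝ :=
  (w + x.1 (hit (exitSet F w) x)).im

variable {F : Set ℂ} {w : ℂ} {x : PathSpace} {M : ℝ} {t : ℝ≥0}

lemma isOpen_UH : IsOpen UH := isOpen_lt continuous_const continuous_im

lemma isOpen_UH_sdiff (hF : IsHHull F) : IsOpen (UH \ F) := by
  have : UH \ F = UH \ closure F := by
    ext z
    refine ⟨fun h => ⟨h.1, fun hz => h.2 ?_⟩, fun h => ⟨h.1, fun hz => h.2 (subset_closure hz)⟩⟩
    rw [← hF.2.1]; exact ⟨hz, h.1⟩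
  rw [this]
  exact isOpen_UH.sdiff isClosed_closure

lemma isClosed_exitSet (hF : IsHHull F) (w : ℂ) : IsClosed (exitSet F w) :=
  (isOpen_UH_sdiff hF).isClosed_compl.preimage (f := fun z => w + z) (by fun_prop)

lemma notMem_of_lt_hit {C : Set ℂ} (h : t < hit C x) : x.1 t ∉ C := fun h' => (hit_le h').not_gt h

lemma mem_of_lt_hit_exitSet (h : t < hit (exitSet F w) x) : w + x.1 t ∈ UH \ F := by
  have := notMem_of_lt_hit h
  rwa [exitSet, mem_ofPred_eq, not_not] at this

lemma im_nonneg_of_le_hit (hw : 0 ≤ w.im) (ht : t ≤ hit (exitSet F w) x) :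
    0 ≤ (w + x.1 t).im := by
  by_contra! h
  have hc : ContinuousOn (fun s => (w + x.1 s).im) (Icc 0 t) := by
    have := x.2.1
    exact (continuous_im.comp (by fun_prop)).continuousOn
  obtain ⟨s, hs, hs2⟩ := intermediate_value_Icc' (zero_le) hc
    (show (w + x.1 t).im / 2 ∈ Icc (w + x.1 t).im (w + x.1 0).im from
      ⟨by linarith, by simp only [x.2.2, add_zero]; linarith⟩)
  simp only at hs2
  have h1 : hit (exitSet F w) x ≤ s := hit_le fun h' => by
    have h3 : 0 < (w + x.1 s).im := h'.1
    linarith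
  have h2 : s = t := le_antisymm hs.2 (ht.trans h1)
  rw [h2] at hs2
  linarith

lemma exitIm_nonneg (hw : 0 ≤ w.im) : 0 ≤ exitIm F w x := im_nonneg_of_le_hit hw le_rfl

lemma exitIm_le (hF : IsHHull F) (hM0 : 0 ≤ M) (hM : ∀ z ∈ F, z.im ≤ M)
    (hx : ∃ t, x.1 t ∈ exitSet F w) : exitIm F w x ≤ M := by
  have h := hit_mem (isClosed_exitSet hF w) hx
  rw [exitSet, mem_ofPred_eq] at h
  by_cases h1 : w + x.1 (hit (exitSet F w) x) ∈ F
  · exact hM _ h1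
  · have : ¬ 0 < (w + x.1 (hit (exitSet F w) x)).im := fun h2 => h ⟨h2, h1⟩
    exact (not_lt.1 this).trans hM0

lemma below_subset_exitSet : below w.im ⊆ exitSet F w := fun z hz h => by
  have h1 : 0 < (w + z).im := h.1
  have h2 : z.im ≤ -w.im := hz
  rw [add_im] at h1
  linarith

lemma IsBM.ae_exists_mem_exitSet {ν : Measure PathSpace} (hν : IsBM ν) (hw : 0 ≤ w.im) :
    ∀ᵐ x ∂ν, ∃ t, x.1 t ∈ exitSet F w := by
  filter_upwards [hν.ae_exists_mem_below hw] with x ⟨t, ht⟩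
  exact ⟨t, below_subset_exitSet ht⟩

lemma exitIm_eq_shift (hx : ∃ t, x.1 t ∈ exitSet F w) {T : ℝ≥0}
    (hT : T ≤ hit (exitSet F w) x) :
    exitIm F w x = exitIm F (w + x.1 T) (shift T x) := by
  have hmem : ∀ s, (shift T x).1 s ∈ exitSet F (w + x.1 T) ↔ x.1 (T + s) ∈ exitSet F w := by
    intro s
    simp only [shift, exitSet, mem_ofPred_eq]
    rw [show w + x.1 T + (x.1 (T + s) - x.1 T) = w + x.1 (T + s) by ring]
  obtain ⟨t, ht⟩ := hx
  have hTt : T ≤ t := hT.trans (hit_le ht)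
  have h : hit (exitSet F w) x = T + hit (exitSet F (w + x.1 T)) (shift T x) := by
    refine le_antisymm ?_ ?_
    · rw [← tsub_le_iff_left]
      refine le_csInf ⟨t - T, (hmem _).2 (by rwa [add_tsub_cancel_of_le hTt])⟩ fun s hs => ?_
      rw [tsub_le_iff_left]
      exact hit_le ((hmem s).1 hs)
    · refine le_csInf ⟨t, ht⟩ fun s hs => ?_
      have hTs : T ≤ s := hT.trans (hit_le hs)
      rw [← le_tsub_iff_left hTs]
      exact hit_le ((hmem _).2 (by rwa [add_tsub_cancel_of_le hTs]))
  rw [exitIm, exitIm, h]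
  simp only [shift]
  congr 1; ring

lemma measurable_exitIm (hF : IsHHull F) :
    Measurable fun p : ℂ × PathSpace => exitIm F p.1 p.2 := by
  have hc : ∀ p : ℂ × PathSpace, Continuous fun t => p.1 + p.2.1 t := fun p => by
    have := p.2.2.1; fun_prop
  have hT : Measurable fun p : ℂ × PathSpace => hit (exitSet F p.1) p.2 :=
    measurable_sInf_mem (Y := fun p : ℂ × PathSpace => fun t => p.1 + p.2.1 t) hc
      (isOpen_UH_sdiff hF).isClosed_compl
      fun s => measurable_fst.add ((measurable_eval s).comp measurable_snd)
  exact measurable_im.comp (measurable_fst.add (measurable_eval_comp hT measurable_snd))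

lemma measurable_exitIm_right (hF : IsHHull F) (w : ℂ) : Measurable (exitIm F w) :=
  (measurable_exitIm hF).comp (measurable_const.prodMk measurable_id)

/-- The absorbed value of the statement is the imaginary part of the exit point. -/
lemma imAtHit_eq (hF : IsHHull F) (hw : 0 < w.im) {f : ℝ → ℂ} (hf : ∀ t : ℝ≥0, f t = w + x.1 t)
    (hx : ∃ t, x.1 t ∈ exitSet F w) : imAtHit f F = exitIm F w x := by
  set τ := hit (exitSet F w) x with hτ
  have hmem : w + x.1 τ ∉ UH \ F := hit_mem (isClosed_exitSet hF w) hx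
  have hge : ∀ s : ℝ, 0 ≤ s → f s ∉ UH \ F → (τ : ℝ) ≤ s := by
    intro s hs hfs
    lift s to ℝ≥0 using hs
    rw [hf] at hfs
    exact_mod_cast hit_le (x := x) (C := exitSet F w) hfs
  have hFge : ENNReal.ofReal τ ≤ hitTime f F := by
    refine le_sInf ?_
    rintro _ ⟨s, ⟨hs, hfs⟩, rfl⟩
    exact ENNReal.ofReal_le_ofReal (hge s hs fun h => h.2 hfs)
  by_cases hU : w + x.1 τ ∈ UH
  · have hFm : w + x.1 τ ∈ F := by by_contra h; exact hmem ⟨hU, h⟩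
    have e1 : hitTime f F = ENNReal.ofReal τ := by
      refine le_antisymm (sInf_le ⟨τ, ⟨τ.coe_nonneg, ?_⟩, rfl⟩) hFge
      rwa [hf]
    have e2 : hitTime f F < exitTime f UH := by
      rw [e1]
      have ho : IsOpen {s : ℝ≥0 | w + x.1 s ∈ UH} := by
        have := x.2.1
        exact isOpen_UH.preimage (by fun_prop)
      obtain ⟨u, hu1, hu2⟩ := exists_Ico_subset_of_mem_nhds (ho.mem_nhds hU) ⟨τ + 1, by simp⟩
      refine lt_of_lt_of_le (b := ENNReal.ofReal u) ?_ (le_sInf ?_)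
      · rw [ENNReal.ofReal_lt_ofReal_iff_of_nonneg τ.coe_nonneg]
        exact_mod_cast hu1
      · rintro _ ⟨s, ⟨hs, hfs⟩, rfl⟩
        refine ENNReal.ofReal_le_ofReal ?_
        by_contra! hlt
        have h1 := hge s hs fun h => hfs h.1
        lift s to ℝ≥0 using hs
        refine hfs ?_
        rw [hf]
        exact hu2 ⟨by exact_mod_cast h1, by exact_mod_cast hlt⟩
    have hex : ∃ t : ℝ, 0 ≤ t ∧ ENNReal.ofReal t = hitTime f F ∧ hitTime f F < exitTime f UH :=
      ⟨τ, τ.coe_nonneg, e1.symm, e2⟩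
    rw [imAtHit, dif_pos hex]
    have e3 : hex.choose = τ :=
      (ENNReal.ofReal_eq_ofReal_iff hex.choose_spec.1 τ.coe_nonneg).1
        (hex.choose_spec.2.1.trans e1)
    rw [e3, hf, exitIm]
  · have e1 : exitTime f UH ≤ ENNReal.ofReal τ := by
      refine sInf_le ⟨τ, ⟨τ.coe_nonneg, ?_⟩, rfl⟩
      rwa [hf, mem_compl_iff]
    have hnex : ¬ ∃ t : ℝ, 0 ≤ t ∧ ENNReal.ofReal t = hitTime f F ∧
        hitTime f F < exitTime f UH := by
      rintro ⟨-, -, -, h⟩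
      exact (h.trans_le e1).not_ge hFge
    rw [imAtHit, dif_neg hnex]
    exact le_antisymm (exitIm_nonneg hw.le) (not_lt.1 hU)

end Exit

section Convergence

lemma eventually_not_ball_subset {D : ℕ → Set ℂ} {Dinf : Set ℂ} {z₀ p : ℂ}
    (h : KernelConvergesTo D Dinf z₀) (ho : IsOpen Dinf)
    (hc : IsPathConnected Dinf) (hz₀ : z₀ ∈ Dinf) (hp : p ∈ closure Dinf) (hp' : p ∉ Dinf)
    {ε : ℝ} (hε : 0 < ε) : ∀ᶠ n in atTop, ¬ Metric.ball p ε ⊆ D n := by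
  by_contra hcon
  rw [not_eventually] at hcon
  obtain ⟨q, hq, hpq⟩ := Metric.mem_closure_iff.1 hp ε hε
  obtain ⟨γ, hγ⟩ := hc.joinedIn z₀ hz₀ q hq
  set K := range γ
  have hK : IsCompact K := isCompact_range γ.continuous
  have hKsub : K ⊆ Dinf := range_subset_iff.2 hγ
  have hKc : IsPreconnected K := isPreconnected_range γ.continuous
  have hzK : z₀ ∈ K := ⟨0, γ.source⟩
  have hqK : q ∈ K := ⟨1, γ.target⟩
  obtain ⟨δ, hδ, hsub⟩ := hK.exists_cthickening_subset_open ho hKsub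
  have hev := h.1 _ hK.cthickening hsub
  set V := Metric.thickening δ K ∪ Metric.ball p ε
  have hV : IsOpen V := Metric.isOpen_thickening.union Metric.isOpen_ball
  have hKV : K ⊆ V := (Metric.self_subset_thickening hδ K).trans subset_union_left
  have hqb : q ∈ Metric.ball p ε := by rwa [Metric.mem_ball, dist_comm]
  have hpU : p ∈ connectedComponentIn V z₀ :=
    (hKc.union q hqK hqb (convex_ball p ε).isPreconnected).subset_connectedComponentIn
      (Or.inl hzK) (union_subset hKV subset_union_right) (Or.inr (Metric.mem_ball_self hε))
  refine hp' (h.2 _ hV.connectedComponentIn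
    (isConnected_connectedComponentIn_iff.2 (hKV hzK)) (mem_connectedComponentIn (hKV hzK)) ?_ hpU)
  refine (Nat.frequently_atTop_iff_infinite.1 (hcon.and_eventually hev)).mono ?_
  rintro n ⟨h1, h2⟩
  exact (connectedComponentIn_subset V z₀).trans
    (union_subset ((Metric.thickening_subset_cthickening _ _).trans h2) (not_not.1 h1))

variable {F : ℕ → Set ℂ} {Finf : Set ℂ} {z₀ w : ℂ} {x : PathSpace}

lemma tendsto_hit_exitSet (hF : ∀ n, IsHHull (F n)) (hFinf : IsHHull Finf)
    (hz₀ : z₀ ∈ UH \ Finf) (hconv : KernelConvergesTo (fun n => UH \ F n) (UH \ Finf) z₀)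
    (hw : w ∈ UH \ Finf) (hx : ∃ t, x.1 t ∈ exitSet Finf w)
    (hl : HasSmallLoops (shift (hit (exitSet Finf w) x) x)) :
    (∀ᶠ n in atTop, ∃ t, x.1 t ∈ exitSet (F n) w) ∧
    Tendsto (fun n => hit (exitSet (F n) w) x) atTop (𝓝 (hit (exitSet Finf w) x)) := by
  set T := hit (exitSet Finf w) x with hT
  have hxc := x.2.1
  have hp' : w + x.1 T ∉ UH \ Finf := hit_mem (isClosed_exitSet hFinf w) hx
  have hT0 : 0 < T := by
    rw [pos_iff_ne_zero]
    rintro h0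
    rw [h0, x.2.2, add_zero] at hp'
    exact hp' hw
  have hp : w + x.1 T ∈ closure (UH \ Finf) := by
    have : T ∈ closure (Iio T) := by rw [closure_Iio' (a := T) ⟨0, hT0⟩]; exact mem_Iic.2 le_rfl
    have hc : Continuous fun t => w + x.1 t := by fun_prop
    refine closure_mono ?_ (mem_closure_image (f := fun t => w + x.1 t) hc.continuousAt this)
    rintro _ ⟨t, ht, rfl⟩
    exact mem_of_lt_hit_exitSet ht
  have hpc : IsPathConnected (UH \ Finf) := by
    have := hFinf.2.2
    exact isPathConnected_iff_pathConnectedSpace.2 inferInstance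
  have upper : ∀ ε : ℝ, 0 < ε → ∀ᶠ n in atTop,
      ∃ t, x.1 t ∈ exitSet (F n) w ∧ (t : ℝ) ≤ T + ε := by
    intro ε hε
    obtain ⟨a, b, hb, hab, ha, hloop⟩ := hl ε hε
    have hsb : 0 < √(b : ℝ) := Real.sqrt_pos.2 (by exact_mod_cast hb)
    filter_upwards [eventually_not_ball_subset hconv
      (isOpen_UH_sdiff hFinf) hpc hz₀ hp hp' (ε := √b / 16) (by positivity)] with n hn
    obtain ⟨v, hv1, hv2⟩ := not_subset.1 hn
    obtain ⟨s, hs, hγ⟩ := exists_notMem_of_near_loop (isOpen_UH_sdiff (hF n)) (hF n).2.2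
      (γ := fun s => w + x.1 (T + (a + b * s.toNNReal))) (c := w + x.1 (T + a)) (w := v)
      (by fun_prop) hsb hv2 (by
        have e : v - (w + x.1 (T + a)) = (v - (w + x.1 T)) - (shift T x).1 a := by
          simp only [shift]; ring
        rw [e]
        refine (norm_sub_le _ _).trans ?_
        rw [← dist_eq_norm]
        have := (Metric.mem_ball.1 hv1).le
        linarith) (by
        intro s hs
        have h1 := hloop s.toNNReal (Real.toNNReal_le_iff_le_coe.2 hs.2)
        rw [Real.coe_toNNReal _ hs.1] at h1
        have e : w + x.1 (T + (a + b * s.toNNReal)) - (w + x.1 (T + a)) - √b * loopPath s =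
            (shift T x).1 (a + b * s.toNNReal) - (shift T x).1 a - √b * loopPath s := by
          simp only [shift]; ring
        rw [e]
        linarith)
    refine ⟨_, hγ, ?_⟩
    push_cast
    rw [Real.coe_toNNReal _ hs.1]
    have : (b : ℝ) * s ≤ b * 6 := mul_le_mul_of_nonneg_left hs.2 b.coe_nonneg
    linarith
  have lower : ∀ u < T, ∀ᶠ n in atTop, ∀ t ≤ u, x.1 t ∉ exitSet (F n) w := by
    intro u hu
    have hK : IsCompact ((fun t => w + x.1 t) '' Icc 0 u) := isCompact_Icc.image (by fun_prop)
    filter_upwards [hconv.1 _ hK (by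
      rintro _ ⟨t, ht, rfl⟩
      exact mem_of_lt_hit_exitSet (ht.2.trans_lt hu))] with n hn t ht
    exact fun h => h (hn ⟨t, ⟨zero_le, ht⟩, rfl⟩)
  have hex : ∀ᶠ n in atTop, ∃ t, x.1 t ∈ exitSet (F n) w :=
    (upper 1 one_pos).mono fun n ⟨t, ht, _⟩ => ⟨t, ht⟩
  refine ⟨hex, tendsto_order.2 ⟨fun u hu => ?_, fun u hu => ?_⟩⟩
  · filter_upwards [lower u hu, hex] with n h1 h2
    by_contra! h
    exact h1 _ h (hit_mem (isClosed_exitSet (hF n) w) h2)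
  · have hu' : 0 < ((u : ℝ) - T) / 2 := by
      have : (T : ℝ) < u := by exact_mod_cast hu
      linarith
    filter_upwards [upper _ hu'] with n ⟨t, ht1, ht2⟩
    refine (hit_le ht1).trans_lt ?_
    rw [← NNReal.coe_lt_coe]
    linarith

variable {ν : Measure PathSpace}

lemma IsBM.ae_hasSmallLoops_hit (hν : IsBM ν) {C : Set ℂ} (hC : IsClosed C)
    (h : ∀ᵐ x ∂ν, ∃ t, x.1 t ∈ C) : ∀ᵐ x ∂ν, HasSmallLoops (shift (hit C x) x) := by
  have := hν.prob
  have hN : ∀ N : ℕ, ∀ᵐ x ∂ν, HasSmallLoops (shift (capHit C N x) x) := by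
    intro N
    have hT := isStop_capHit hC N
    have hm : Measurable fun x => ((capHit C N x, x.1 (capHit C N x)), shift (capHit C N x) x) :=
      (hT.measurable.prodMk (measurable_eval_comp hT.measurable measurable_id)).prodMk
        (measurable_shift_comp hT.measurable measurable_id)
    have : IsProbabilityMeasure (ν.map fun x => (capHit C N x, x.1 (capHit C N x))) :=
      Measure.isProbabilityMeasure_map
        (hT.measurable.prodMk (measurable_eval_comp hT.measurable measurable_id)).aemeasurable
    have hmap : ν.map (fun x => shift (capHit C N x) x) = ν := by
      have := congrArg (Measure.map Prod.snd) (hν.strong_markov hT)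
      rwa [Measure.map_map measurable_snd hm, Measure.map_snd_prod, measure_univ, one_smul] at this
    have hl := hν.ae_hasSmallLoops
    rw [← hmap] at hl
    exact ae_of_ae_map (measurable_shift_comp hT.measurable measurable_id).aemeasurable hl
  filter_upwards [ae_all_iff.2 hN, h] with x h1 h2
  obtain ⟨N, hN⟩ := (eventually_capHit_eq_hit h2).exists
  rw [← hN]
  exact h1 N

/-- Convergence of the expected exit height. -/
theorem IsBM.tendsto_integral_exitIm (hν : IsBM ν) (hF : ∀ n, IsHHull (F n))
    (hFinf : IsHHull Finf) (hz₀ : z₀ ∈ UH \ Finf)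
    (hconv : KernelConvergesTo (fun n => UH \ F n) (UH \ Finf) z₀) (hw : w ∈ UH \ Finf)
    {M : ℝ} (hM0 : 0 ≤ M) (hM : ∀ n, ∀ z ∈ F n, z.im ≤ M) :
    Tendsto (fun n => ∫ x, exitIm (F n) w x ∂ν) atTop (𝓝 (∫ x, exitIm Finf w x ∂ν)) := by
  have := hν.prob
  have hw0 : 0 ≤ w.im := le_of_lt hw.1
  refine tendsto_integral_of_dominated_convergence (fun _ => M)
    (fun n => (measurable_exitIm_right (hF n) w).aestronglyMeasurable) (integrable_const _)
    (fun n => ?_) ?_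
  · filter_upwards [hν.ae_exists_mem_exitSet (F := F n) hw0] with x hx
    rw [Real.norm_of_nonneg (exitIm_nonneg hw0)]
    exact exitIm_le (hF n) hM0 (hM n) hx
  · filter_upwards [hν.ae_exists_mem_exitSet (F := Finf) hw0,
      hν.ae_hasSmallLoops_hit (isClosed_exitSet hFinf w) (hν.ae_exists_mem_exitSet hw0)]
      with x hx hl
    have h := (tendsto_hit_exitSet hF hFinf hz₀ hconv hw hx hl).2
    have hc : Continuous fun t => (w + x.1 t).im := by
      have := x.2.1
      exact continuous_im.comp (by fun_prop)
    exact (hc.tendsto _).comp h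

end Convergence

section Poisson

variable {F G : Set ℂ} {w : ℂ} {M : ℝ} {ν : Measure PathSpace}

lemma capHit_le_hit {C : Set ℂ} (hC : IsClosed C) {N : ℝ≥0} {x : PathSpace}
    (hx : ∃ t, x.1 t ∈ C) : capHit C N x ≤ hit C x := capHit_le_of_mem (hit_mem hC hx)

lemma IsBM.ae_norm_exitIm_le (hν : IsBM ν) (hF : IsHHull F) (hM0 : 0 ≤ M)
    (hM : ∀ z ∈ F, z.im ≤ M) (hw : 0 ≤ w.im) : ∀ᵐ x ∂ν, ‖exitIm F w x‖ ≤ M := by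
  filter_upwards [hν.ae_exists_mem_exitSet (F := F) hw] with x hx
  rw [Real.norm_of_nonneg (exitIm_nonneg hw)]
  exact exitIm_le hF hM0 hM hx

lemma IsBM.integrable_exitIm (hν : IsBM ν) (hF : IsHHull F) (hM0 : 0 ≤ M)
    (hM : ∀ z ∈ F, z.im ≤ M) (hw : 0 ≤ w.im) : Integrable (exitIm F w) ν := by
  have := hν.prob
  exact .of_bound (measurable_exitIm_right hF w).aestronglyMeasurable M
    (hν.ae_norm_exitIm_le hF hM0 hM hw)

lemma IsBM.integral_exitIm_nonneg (hw : 0 ≤ w.im) : 0 ≤ ∫ x, exitIm F w x ∂ν :=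
  integral_nonneg fun _ => exitIm_nonneg hw

lemma IsBM.norm_integral_exitIm_le (hν : IsBM ν) (hF : IsHHull F) (hM0 : 0 ≤ M)
    (hM : ∀ z ∈ F, z.im ≤ M) (hw : 0 ≤ w.im) : ‖∫ x, exitIm F w x ∂ν‖ ≤ M := by
  have := hν.prob
  simpa using norm_integral_le_of_norm_le_const (hν.ae_norm_exitIm_le hF hM0 hM hw)

lemma measurableSet_hitBy (hF : IsHHull F) (w : ℂ) (N : ℝ≥0) :
    MeasurableSet {x : PathSpace | ∃ s ≤ N, x.1 s ∈ exitSet F w} :=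
  measurableSet_exists_le_mem (fun x => x.2.1) (isClosed_exitSet hF w)
    fun s _ => measurable_eval s

lemma IsBM.tendsto_integral_indicator_exitIm (hν : IsBM ν) (hF : IsHHull F) (hM0 : 0 ≤ M)
    (hM : ∀ z ∈ F, z.im ≤ M) (hw : 0 ≤ w.im) :
    Tendsto (fun N : ℕ => ∫ x, indicator {x : PathSpace | ∃ s ≤ (N : ℝ≥0), x.1 s ∈ exitSet F w}
      (exitIm F w) x ∂ν) atTop (𝓝 (∫ x, exitIm F w x ∂ν)) := by
  refine tendsto_integral_of_dominated_convergence (fun x => ‖exitIm F w x‖)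
    (fun N => ((measurable_exitIm_right hF w).indicator
      (measurableSet_hitBy hF w N)).aestronglyMeasurable)
    (hν.integrable_exitIm hF hM0 hM hw).norm
    (fun N => .of_forall fun x => norm_indicator_le_norm_self _ _) ?_
  filter_upwards [hν.ae_exists_mem_exitSet (F := F) hw] with x ⟨t, ht⟩
  refine tendsto_const_nhds.congr' ?_
  obtain ⟨n, hn⟩ := exists_nat_ge t
  filter_upwards [eventually_ge_atTop n] with N hN
  rw [indicator_of_mem]
  exact ⟨t, hn.trans (by exact_mod_cast hN), ht⟩

/-- The expected exit height is monotone in the hull. -/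
lemma IsBM.integral_exitIm_mono (hν : IsBM ν) (hF : IsHHull F) (hG : IsHHull G) (hFG : F ⊆ G)
    (hM0 : 0 ≤ M) (hM : ∀ z ∈ G, z.im ≤ M) (hw : 0 ≤ w.im) :
    ∫ x, exitIm F w x ∂ν ≤ ∫ x, exitIm G w x ∂ν := by
  have := hν.prob
  have hMF : ∀ z ∈ F, z.im ≤ M := fun z hz => hM z (hFG hz)
  have hsub : exitSet F w ⊆ exitSet G w := fun z hz h => hz ⟨h.1, fun h' => h.2 (hFG h')⟩
  refine le_of_tendsto_of_tendsto' (hν.tendsto_integral_indicator_exitIm hF hM0 hMF hw)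
    (hν.tendsto_integral_indicator_exitIm hG hM0 hM hw) fun N => ?_
  obtain ⟨iF, eF⟩ := hν.integrable_im_stop (isStop_capHit (isClosed_exitSet hF w) N)
    (N := N) fun x => capHit_le
  obtain ⟨iG, eG⟩ := hν.integrable_im_stop (isStop_capHit (isClosed_exitSet hG w) N)
    (N := N) fun x => capHit_le
  have jF := (hν.integrable_exitIm hF hM0 hMF hw).indicator (measurableSet_hitBy hF w N)
  have jG := (hν.integrable_exitIm hG hM0 hM hw).indicator (measurableSet_hitBy hG w N)
  have key := integral_mono_ae (μ := ν) (jF.add iG) (jG.add iF) (by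
    filter_upwards [hν.ae_exists_mem_exitSet (F := F) hw] with x hx
    simp only [Pi.add_apply]
    by_cases h1 : x ∈ {x : PathSpace | ∃ s ≤ (N : ℝ≥0), x.1 s ∈ exitSet F w}
    · have h2 : x ∈ {x : PathSpace | ∃ s ≤ (N : ℝ≥0), x.1 s ∈ exitSet G w} := by
        obtain ⟨s, hs, h⟩ := h1
        exact ⟨s, hs, hsub h⟩
      rw [indicator_of_mem h1, indicator_of_mem h2]
      obtain ⟨s, hs, h⟩ := h1
      rw [capHit_eq_hit h hs, capHit_eq_hit (hsub h) hs, exitIm, exitIm, add_im, add_im]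
      exact le_of_eq (by ring)
    · rw [indicator_of_notMem h1]
      by_cases h2 : x ∈ {x : PathSpace | ∃ s ≤ (N : ℝ≥0), x.1 s ∈ exitSet G w}
      · rw [indicator_of_mem h2]
        obtain ⟨s, hs, h⟩ := h2
        have := im_nonneg_of_le_hit hw
          (capHit_le_hit (isClosed_exitSet hF w) hx (N := N))
        rw [capHit_eq_hit h hs, exitIm, add_im]
        rw [add_im] at this
        linarith
      · rw [indicator_of_notMem h2]
        have e : ∀ C : Set ℂ, IsClosed C → x ∉ {x : PathSpace | ∃ s ≤ (N : ℝ≥0), x.1 s ∈ C} →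
            capHit C N x = N := fun C hC h =>
          (capHit_mem hC).resolve_left fun h' => h ⟨_, capHit_le, h'⟩
        rw [e _ (isClosed_exitSet hF w) h1, e _ (isClosed_exitSet hG w) h2])
  simp only [Pi.add_apply] at key
  rw [integral_add jF iG, integral_add jG iF, eF, eG] at key
  linarith

/-- The expected exit height at a high point is a Poisson integral over a horizontal line. -/
lemma IsBM.integral_exitIm_eq_cauchy (hν : IsBM ν) (hF : IsHHull F) (hM0 : 0 ≤ M)
    (hM : ∀ z ∈ F, z.im ≤ M) {h : ℝ≥0} (hh : h ≠ 0) :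
    ∫ x, exitIm F (((M + h : ℝ) : ℂ) * I) x ∂ν =
      ∫ v, (∫ x, exitIm F (v + M * I) x ∂ν) ∂cauchyMeasure 0 h := by
  have := hν.prob
  set w : ℂ := ((M + h : ℝ) : ℂ) * I with hw
  have hwi : w.im = M + h := by simp [hw]
  have hw0 : 0 ≤ w.im := by rw [hwi]; positivity
  have hum : StronglyMeasurable fun z => ∫ x, exitIm F z x ∂ν :=
    (measurable_exitIm hF).stronglyMeasurable.integral_prod_right'
  have hh' : (0 : ℝ) ≤ (h : ℝ) := h.coe_nonneg
  have hle : ∀ (N : ℕ) (x : PathSpace), (∃ t, x.1 t ∈ exitSet F w) →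
      capHit (below h) N x ≤ hit (exitSet F w) x := by
    intro N x hx
    by_contra! hlt
    have h1 := notMem_of_lt_capHit hlt
    have h2 := hit_mem (isClosed_exitSet hF w) hx
    have h3 : -(h : ℝ) < (x.1 (hit (exitSet F w) x)).im := not_le.1 h1
    have h4 : M < (w + x.1 (hit (exitSet F w) x)).im := by rw [add_im, hwi]; linarith
    exact h2 ⟨hM0.trans_lt h4, fun h5 => (hM _ h5).not_gt h4⟩
  have step : ∀ N : ℕ, ∫ x, exitIm F w x ∂ν =
      ∫ x, (∫ x', exitIm F (w + x.1 (capHit (below h) N x)) x' ∂ν) ∂ν := by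
    intro N
    have hsh : ∀ᵐ x ∂ν, exitIm F w x =
        exitIm F (w + x.1 (capHit (below h) N x)) (shift (capHit (below h) N x) x) := by
      filter_upwards [hν.ae_exists_mem_exitSet (F := F) hw0] with x hx
      exact exitIm_eq_shift hx (hle N x hx)
    rw [integral_congr_ae hsh]
    refine (hν.integral_strong_markov (isStop_capHit (isClosed_below h) N)
      (F := fun p : (ℝ≥0 × ℂ) × PathSpace => exitIm F (w + p.1.2) p.2) ?_ ?_).2
    · exact ((measurable_exitIm hF).comp
        ((measurable_const.add (measurable_snd.comp measurable_fst)).prodMk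
          measurable_snd)).stronglyMeasurable
    · exact (hν.integrable_exitIm hF hM0 hM hw0).congr hsh
  have hmeas : ∀ T : PathSpace → ℝ≥0, Measurable T → AEStronglyMeasurable
      (fun x : PathSpace => ∫ x', exitIm F (w + x.1 (T x)) x' ∂ν) ν := fun T hT =>
    (hum.comp_measurable
      (measurable_const.add (measurable_eval_comp hT measurable_id))).aestronglyMeasurable
  have lim : Tendsto (fun N : ℕ => ∫ x, (∫ x', exitIm F (w + x.1 (capHit (below h) N x)) x' ∂ν) ∂ν)
      atTop (𝓝 (∫ x, (∫ x', exitIm F (w + x.1 (hit (below h) x)) x' ∂ν) ∂ν)) := by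
    refine tendsto_integral_of_dominated_convergence (fun _ => M)
      (fun N => hmeas _ (measurable_capHit (isClosed_below h) N)) (integrable_const _)
      (fun N => .of_forall fun x => ?_) ?_
    · refine hν.norm_integral_exitIm_le hF hM0 hM ?_
      have := neg_le_im_of_le_capHit hh' (x := x) (N := N) le_rfl
      rw [add_im, hwi]
      linarith
    · filter_upwards [hν.ae_exists_mem_below hh'] with x hx
      refine tendsto_const_nhds.congr' ?_
      filter_upwards [eventually_capHit_eq_hit hx] with N hN
      rw [hN]
  have e1 := tendsto_nhds_unique (tendsto_const_nhds.congr step) lim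
  have hre : Measurable fun x : PathSpace => (x.1 (hit (below h) x)).re :=
    measurable_re.comp (measurable_eval_comp (measurable_hit (isClosed_below h)) measurable_id)
  rw [e1, ← hν.map_hit_below hh, integral_map hre.aemeasurable]
  · refine integral_congr_ae ?_
    filter_upwards [hν.ae_exists_mem_below hh'] with x hx
    have hz : w + x.1 (hit (below h) x) = ((x.1 (hit (below h) x)).re : ℂ) + M * I := by
      apply Complex.ext
      · simp [hw]
      · rw [add_im, hwi, im_hit_below hh' hx]
        simp
    simp only [hz]
  · exact (hum.comp_measurable (by fun_prop)).aestronglyMeasurable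

end Poisson

section HasHcap

variable {Ω : Type*} [MeasurableSpace Ω] {F : Set ℂ} {ν : Measure PathSpace}

lemma integral_imAtHit_eq (BM : PlanarBM Ω) (hν : IsBM ν) (hF : IsHHull F) {w : ℂ}
    (hw : 0 < w.im) :
    ∫ ω, imAtHit (fun t => BM.Z t ω) F ∂BM.P w = ∫ x, exitIm F w x ∂ν := by
  obtain ⟨X, hX, hlaw, hpath⟩ := exists_path BM w
  rw [hν.unique hlaw, integral_map hX.aemeasurable
    (measurable_exitIm_right hF w).aestronglyMeasurable]
  refine integral_congr_ae ?_
  filter_upwards [hpath, ae_of_ae_map hX.aemeasurable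
    (hlaw.ae_exists_mem_exitSet (F := F) hw.le)] with ω h1 h2
  exact imAtHit_eq hF hw h1.2 h2

end HasHcap

section PoissonLimit

variable {M : ℝ} {g : ℝ → ℝ}

/-- The rescaled Poisson kernel of the half-plane above height `M`, seen from height `y`. -/
noncomputable def poissonKer (M y v : ℝ) : ℝ := y * cauchyPDFReal 0 (y - M).toNNReal v

lemma poissonKer_eq {y : ℝ} (hy : M < y) (v : ℝ) :
    poissonKer M y v = Real.pi⁻¹ * (y * (y - M) / (v ^ 2 + (y - M) ^ 2)) := by
  rw [poissonKer, cauchyPDFReal_def, Real.coe_toNNReal _ (by linarith), sub_zero, div_eq_mul_inv]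
  ring

lemma tendsto_poissonKer (M v : ℝ) :
    Tendsto (fun y => poissonKer M y v) atTop (𝓝 Real.pi⁻¹) := by
  have h0 : Tendsto (fun y : ℝ => (y - M)⁻¹) atTop (𝓝 0) :=
    tendsto_inv_atTop_zero.comp (tendsto_atTop_add_const_right _ (-M) tendsto_id)
  have h1 : Tendsto (fun y : ℝ => Real.pi⁻¹ * ((1 + M * (y - M)⁻¹) /
      (1 + v ^ 2 * (y - M)⁻¹ ^ 2))) atTop (𝓝 (Real.pi⁻¹ * ((1 + M * 0) / (1 + v ^ 2 * 0 ^ 2)))) :=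
    (((h0.const_mul M).const_add 1).div (((h0.pow 2).const_mul _).const_add 1)
      (by norm_num)).const_mul _
  simp only [mul_zero, add_zero, ne_eq, OfNat.ofNat_ne_zero, not_false_eq_true, zero_pow,
    div_one, mul_one] at h1
  refine h1.congr' ?_
  filter_upwards [eventually_gt_atTop M] with y hy
  rw [poissonKer_eq hy]
  have h : y - M ≠ 0 := by linarith
  have h2 : v ^ 2 + (y - M) ^ 2 ≠ 0 := by positivity
  have h3 : 1 + v ^ 2 * (y - M)⁻¹ ^ 2 ≠ 0 := by positivity
  congr 1
  rw [div_eq_div_iff h3 h2]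
  field_simp
  ring

lemma poissonKer_nonneg {y : ℝ} (hM : 0 ≤ M) (hy : M < y) (v : ℝ) : 0 ≤ poissonKer M y v := by
  rw [poissonKer_eq hy]
  have h1 : 0 < y - M := by linarith
  have h2 : 0 < y := by linarith
  positivity

lemma poissonKer_le {y : ℝ} (hy : M < y) (hy2 : 2 * M ≤ y) (v : ℝ) :
    poissonKer M y v ≤ Real.pi⁻¹ * 2 := by
  rw [poissonKer_eq hy]
  have h1 : 0 < y - M := by linarith
  refine mul_le_mul_of_nonneg_left ?_ (by positivity)
  rw [div_le_iff₀ (by positivity)]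
  nlinarith [sq_nonneg v]

lemma measurable_poissonKer (M y : ℝ) : Measurable (poissonKer M y) :=
  measurable_const.mul (measurable_cauchyPDFReal _ _)

lemma mul_integral_cauchyMeasure {y : ℝ} (hy : M < y) (g : ℝ → ℝ) :
    y * ∫ v, g v ∂cauchyMeasure 0 (y - M).toNNReal = ∫ v, poissonKer M y v * g v := by
  have hγ : (y - M).toNNReal ≠ 0 := by
    rw [ne_eq, Real.toNNReal_eq_zero]
    linarith
  rw [cauchyMeasure_of_scale_ne_zero 0 hγ,
    integral_withDensity_eq_integral_toReal_smul (by fun_prop)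
    (.of_forall fun x => by simp [cauchyPDF]), ← integral_const_mul]
  congr 1
  ext v
  rw [cauchyPDF, ENNReal.toReal_ofReal (cauchyPDF_pos 0 hγ v).le, poissonKer, smul_eq_mul,
    mul_assoc]

lemma tendsto_integral_poissonKer (hM : 0 ≤ M) (hg : Integrable g) :
    Tendsto (fun y => ∫ v, poissonKer M y v * g v) atTop (𝓝 (Real.pi⁻¹ * ∫ v, g v)) := by
  rw [← integral_const_mul]
  refine tendsto_integral_filter_of_dominated_convergence (fun v => Real.pi⁻¹ * 2 * ‖g v‖)
    (.of_forall fun y => (measurable_poissonKer M y).aestronglyMeasurable.mul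
      hg.aestronglyMeasurable) ?_ (hg.norm.const_mul _)
    (.of_forall fun v => (tendsto_poissonKer M v).mul_const _)
  filter_upwards [eventually_gt_atTop M, eventually_ge_atTop (2 * M)] with y h1 h2
  refine .of_forall fun v => ?_
  rw [norm_mul, Real.norm_of_nonneg (poissonKer_nonneg hM h1 v)]
  exact mul_le_mul_of_nonneg_right (poissonKer_le h1 h2 v) (norm_nonneg _)

lemma integrable_of_tendsto_integral_poissonKer (hM : 0 ≤ M) (hg : Measurable g)
    (hg0 : ∀ v, 0 ≤ g v) {B : ℝ} (hgB : ∀ v, g v ≤ B) {c : ℝ}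
    (h : Tendsto (fun y => ∫ v, poissonKer M y v * g v) atTop (𝓝 c)) : Integrable g := by
  have hlim : Tendsto (fun n : ℕ => ∫ v, poissonKer M n v * g v) atTop (𝓝 c) :=
    h.comp tendsto_natCast_atTop_atTop
  have hI : Integrable fun v => Real.pi⁻¹ * g v := by
    refine integrable_of_tendsto (G := fun (n : ℕ) v => poissonKer M n v * g v)
      (.of_forall fun v =>
        ((tendsto_poissonKer M v).comp tendsto_natCast_atTop_atTop).mul_const (g v))
      (fun n => ((measurable_poissonKer M n).mul hg).aestronglyMeasurable) ?_
    have hev : ∀ᶠ n : ℕ in atTop, ENNReal.ofReal (∫ v, poissonKer M n v * g v) =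
        ∫⁻ v, ‖poissonKer M n v * g v‖ₑ := by
      filter_upwards [tendsto_natCast_atTop_atTop.eventually (eventually_gt_atTop M)] with n hn
      have hi : Integrable fun v => poissonKer M n v * g v := by
        refine Integrable.mul_bdd (c := B) ((integrable_cauchyPDFReal 0).const_mul _)
          hg.aestronglyMeasurable (.of_forall fun v => ?_)
        rw [Real.norm_of_nonneg (hg0 v)]
        exact hgB v
      have h0 : ∀ v, 0 ≤ poissonKer M n v * g v := fun v =>
        mul_nonneg (poissonKer_nonneg hM hn v) (hg0 v)
      rw [ofReal_integral_eq_lintegral_ofReal hi (.of_forall h0)]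
      congr 1
      ext v
      rw [Real.enorm_of_nonneg (h0 v)]
    have h2 := ((ENNReal.tendsto_ofReal hlim).congr' hev).liminf_eq
    rw [h2]
    exact ENNReal.ofReal_ne_top
  simpa [← mul_assoc, Real.pi_ne_zero] using hI.const_mul Real.pi

end PoissonLimit

section Capacity

variable {Ω : Type*} [MeasurableSpace Ω] {F G : Set ℂ} {ν : Measure PathSpace} {M : ℝ}

/-- Expected exit heights from the line at height `M`. -/
noncomputable def lineExit (ν : Measure PathSpace) (M : ℝ) (F : Set ℂ) (v : ℝ) : ℝ :=
  ∫ x, exitIm F (v + M * I) x ∂ν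

lemma IsBM.measurable_lineExit (hν : IsBM ν) (hF : IsHHull F) : Measurable (lineExit ν M F) := by
  have := hν.prob
  have hum : StronglyMeasurable fun z => ∫ x, exitIm F z x ∂ν :=
    (measurable_exitIm hF).stronglyMeasurable.integral_prod_right'
  exact (hum.comp_measurable (g := fun v : ℝ => (v : ℂ) + M * I) (by fun_prop)).measurable

lemma lineExit_nonneg (hM0 : 0 ≤ M) (v : ℝ) : 0 ≤ lineExit ν M F v :=
  IsBM.integral_exitIm_nonneg (by simpa)

lemma hasHcap_iff (BM : PlanarBM Ω) (hν : IsBM ν) (hF : IsHHull F) (hM0 : 0 ≤ M)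
    (hM : ∀ z ∈ F, z.im ≤ M) {a : ℝ} : HasHcap BM F a ↔
      Tendsto (fun y => ∫ v, poissonKer M y v * lineExit ν M F v) atTop (𝓝 a) := by
  refine tendsto_congr' ?_
  filter_upwards [eventually_gt_atTop M] with y hy
  have hγ : (y - M).toNNReal ≠ 0 := by
    rw [ne_eq, Real.toNNReal_eq_zero]
    linarith
  have h := hν.integral_exitIm_eq_cauchy hF hM0 hM hγ
  rw [Real.coe_toNNReal _ (by linarith), add_sub_cancel] at h
  rw [integral_imAtHit_eq BM hν hF (by simpa using hM0.trans_lt hy), h,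
    mul_integral_cauchyMeasure hy]
  rfl

lemma hasHcap_of_integrable (BM : PlanarBM Ω) (hν : IsBM ν) (hF : IsHHull F) (hM0 : 0 ≤ M)
    (hM : ∀ z ∈ F, z.im ≤ M) (hi : Integrable (lineExit ν M F)) :
    HasHcap BM F (Real.pi⁻¹ * ∫ v, lineExit ν M F v) :=
  (hasHcap_iff BM hν hF hM0 hM).2 (tendsto_integral_poissonKer hM0 hi)

lemma HasHcap.integrable_lineExit {BM : PlanarBM Ω} (hν : IsBM ν) (hF : IsHHull F) (hM0 : 0 ≤ M)
    (hM : ∀ z ∈ F, z.im ≤ M) {a : ℝ} (h : HasHcap BM F a) : Integrable (lineExit ν M F) :=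
  integrable_of_tendsto_integral_poissonKer hM0 (hν.measurable_lineExit hF)
    (lineExit_nonneg hM0)
    (fun v => (Real.le_norm_self _).trans (hν.norm_integral_exitIm_le hF hM0 hM (by simpa)))
    ((hasHcap_iff BM hν hF hM0 hM).1 h)

lemma IsBM.norm_lineExit_le (hν : IsBM ν) (hF : IsHHull F) (hG : IsHHull G) (hFG : F ⊆ G)
    (hM0 : 0 ≤ M) (hM : ∀ z ∈ G, z.im ≤ M) (v : ℝ) :
    ‖lineExit ν M F v‖ ≤ lineExit ν M G v := by
  rw [Real.norm_of_nonneg (lineExit_nonneg hM0 v)]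
  exact hν.integral_exitIm_mono hF hG hFG hM0 hM (by simpa)

end Capacity

end HcapBM

/-- Continuity of half-plane capacity: if ℍ-hulls `F n`, `Finf` are contained in
a hull `Ftil` with bounded imaginary part and finite half-plane capacity, and
`ℍ \ F n → ℍ \ Finf` in the kernel sense w.r.t. some `z₀ ∈ ℍ \ Ftil`, then
`hcap (F n) → hcap Finf`. -/
theorem hcap_continuous {Ω : Type*} [MeasurableSpace Ω] (BM : PlanarBM Ω)
    (Ftil : Set ℂ) (F : ℕ → Set ℂ) (Finf : Set ℂ) (z₀ : ℂ)
    (hFtil : IsHHull Ftil) (hIm : BddAbove (Complex.im '' Ftil))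
    (hfin : ∃ c, HasHcap BM Ftil c)
    (hF : ∀ n, IsHHull (F n)) (hFinf : IsHHull Finf)
    (hsub : ∀ n, F n ⊆ Ftil) (hsubinf : Finf ⊆ Ftil)
    (hz₀ : z₀ ∈ UH \ Ftil)
    (hconv : KernelConvergesTo (fun n => UH \ F n) (UH \ Finf) z₀) :
    ∃ (a : ℕ → ℝ) (ainf : ℝ), (∀ n, HasHcap BM (F n) (a n)) ∧
      HasHcap BM Finf ainf ∧ Tendsto a atTop (nhds ainf) := by
  obtain ⟨X, -, hν, -⟩ := HcapBM.exists_path BM 0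
  obtain ⟨c, hc⟩ := hfin
  obtain ⟨B, hB⟩ := hIm
  set ν := (BM.P 0).map X
  set M : ℝ := max B 0 + 1 with hM
  have hMpos : 0 < M := by positivity
  have hlt : ∀ z ∈ Ftil, z.im < M := fun z hz =>
    ((hB ⟨z, hz, rfl⟩).trans (le_max_left B 0)).trans_lt (lt_add_one _)
  have hle : ∀ z ∈ Ftil, z.im ≤ M := fun z hz => (hlt z hz).le
  have hi := HcapBM.HasHcap.integrable_lineExit hν hFtil hMpos.le hle hc
  have hint : ∀ G, IsHHull G → G ⊆ Ftil → Integrable (HcapBM.lineExit ν M G) := fun G hG hGF =>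
    hi.mono' (hν.measurable_lineExit hG).aestronglyMeasurable
      (.of_forall (hν.norm_lineExit_le hG hFtil hGF hMpos.le hle))
  refine ⟨_, _, fun n => HcapBM.hasHcap_of_integrable BM hν (hF n) hMpos.le
    (fun z hz => hle z (hsub n hz)) (hint _ (hF n) (hsub n)),
    HcapBM.hasHcap_of_integrable BM hν hFinf hMpos.le
      (fun z hz => hle z (hsubinf hz)) (hint _ hFinf hsubinf), Tendsto.const_mul _ ?_⟩
  refine tendsto_integral_of_dominated_convergence (HcapBM.lineExit ν M Ftil)
    (fun n => (hν.measurable_lineExit (hF n)).aestronglyMeasurable) hi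
    (fun n => .of_forall (hν.norm_lineExit_le (hF n) hFtil (hsub n) hMpos.le hle))
    (.of_forall fun v => ?_)
  refine hν.tendsto_integral_exitIm hF hFinf ⟨hz₀.1, fun h => hz₀.2 (hsubinf h)⟩ hconv
    ⟨?_, fun h => ?_⟩ hMpos.le fun n z hz => hle z (hsub n hz)
  · show 0 < ((v : ℂ) + M * Complex.I).im
    simpa using hMpos
  · have := hlt _ (hsubinf h)
    simp at this
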